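/- arXiv:2309.02806 — 3 statements merged into one kernel-verified Lean document; each statement's English description precedes it below -/
import Mathlib

section
/- Assume c(x,y) = k(y−x) with k satisfying (H1). Let f, f_n ∈ L^1(ℝ^d,[0,1]) be such that the sequence of measures f_n·Leb is tight (for every ε > 0 there is a compact K with ∫_{ℝ^d∖K} f_n ≤ ε for all n) and f_n·Leb converges to f·Leb in duality with C_b(ℝ^d). Then Υ(f_n) → Υ(f) as n → ∞. -/
open MeasureTheory ENNReal Filter Set

noncomputable section

/-- Euclidean space `ℝ^d`. -/
abbrev Rd (d : ℕ) : Type := EuclideanSpace ℝ (Fin d)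

/-- The measure `f · Leb` on `ℝ^d`. -/
def fMeas {d : ℕ} (f : Rd d → ℝ) : Measure (Rd d) :=
  MeasureTheory.volume.withDensity fun x => ENNReal.ofReal (f x)

/-- The set `Π_f` of admissible exterior transport plans: first marginal `f · Leb`,
second marginal `≤ (1 - f) · Leb`. -/
def ExtPlans {d : ℕ} (f : Rd d → ℝ) : Set (Measure (Rd d × Rd d)) :=
  {γ | γ.map Prod.fst = fMeas f ∧ γ.map Prod.snd ≤ fMeas fun x => 1 - f x}

/-- The transport cost `∫ c dγ` of a plan `γ`. -/
def planCost {d : ℕ} (c : Rd d → Rd d → ℝ) (γ : Measure (Rd d × Rd d)) : ℝ≥0∞ :=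
  ∫⁻ p, ENNReal.ofReal (c p.1 p.2) ∂γ

/-- The functional `Υ(f) = inf { ∫ c dγ : γ ∈ Π_f }`. -/
def Ups {d : ℕ} (c : Rd d → Rd d → ℝ) (f : Rd d → ℝ) : ℝ≥0∞ :=
  ⨅ γ ∈ ExtPlans f, planCost c γ

/-- `f ∈ L¹(ℝ^d, [0,1])`. -/
def InUnit {d : ℕ} (f : Rd d → ℝ) : Prop :=
  Integrable f MeasureTheory.volume ∧ ∀ x, 0 ≤ f x ∧ f x ≤ 1

/-- `f ∈ L¹_m`: in `L¹(ℝ^d,[0,1])` with `∫ f ≤ m`. -/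
def MemL1m {d : ℕ} (m : ℝ) (f : Rd d → ℝ) : Prop := InUnit f ∧ (∫ x, f x) ≤ m

/-- The energy `ℰ(m) = sup { Υ(f) : f ∈ L¹(ℝ^d,[0,1]), ∫ f = m }`. -/
def Energy {d : ℕ} (c : Rd d → Rd d → ℝ) (m : ℝ) : ℝ≥0∞ :=
  ⨆ f ∈ {f : Rd d → ℝ | InUnit f ∧ (∫ x, f x) = m}, Ups c f

/-- Hypothesis (H1): `k` continuous, `k 0 = 0`, `k → ∞` at infinity. -/
def H1 {d : ℕ} (k : Rd d → ℝ) : Prop :=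
  Continuous k ∧ k 0 = 0 ∧ Tendsto k (Bornology.cobounded (Rd d)) atTop

/-- Hypothesis (H2). -/
def H2 {d : ℕ} (k : Rd d → ℝ) : Prop :=
  ∀ x : Rd d, x ≠ 0 →
    0 < Filter.limsup
      (fun r : ℝ =>
        MeasureTheory.volume (Metric.ball x r ∩ {y | k y < k x}) / ENNReal.ofReal (r ^ d))
      (nhdsWithin 0 (Set.Ioi 0))

/-- Hypothesis (H3): `r ↦ k (r σ)` increasing on `[0, ∞)` for every unit direction `σ`. -/
def H3 {d : ℕ} (k : Rd d → ℝ) : Prop :=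
  ∀ σ : Rd d, ‖σ‖ = 1 → StrictMonoOn (fun r : ℝ => k (r • σ)) (Set.Ici 0)

/-- Translation-invariant cost `c(x,y) = k(y - x)`. -/
def transCost {d : ℕ} (k : Rd d → ℝ) : Rd d → Rd d → ℝ := fun x y => k (y - x)

/-- The support of a measure: points all of whose open neighbourhoods have positive measure. -/
def msupport {α : Type*} [TopologicalSpace α] [MeasurableSpace α] (μ : Measure α) : Set α :=
  {x | ∀ U : Set α, IsOpen U → x ∈ U → 0 < μ U}

section

variable {d : ℕ}

theorem Ups_congr {c : Rd d → Rd d → ℝ} {f g : Rd d → ℝ} (h : f =ᵐ[volume] g) :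
    Ups c f = Ups c g := by
  have h1 : fMeas f = fMeas g :=
    withDensity_congr_ae (h.mono fun x hx => by simp only [hx])
  have h2 : (fMeas fun x => 1 - f x) = fMeas fun x => 1 - g x :=
    withDensity_congr_ae (h.mono fun x hx => by simp only [hx])
  simp only [Ups, ExtPlans, h1, h2]

theorem InUnit.exists_measurable {f : Rd d → ℝ} (hf : InUnit f) :
    ∃ g : Rd d → ℝ, Measurable g ∧ InUnit g ∧ f =ᵐ[volume] g := by
  obtain ⟨g, hg, hfg⟩ := hf.1.aestronglyMeasurable
  have hae : f =ᵐ[volume] fun x => max 0 (min 1 (g x)) := by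
    filter_upwards [hfg] with x hx
    rw [← hx, min_eq_right (hf.2 x).2, max_eq_right (hf.2 x).1]
  refine ⟨_, ?_, ⟨hf.1.congr hae, fun x => ⟨le_max_left _ _, ?_⟩⟩, hae⟩
  · have := hg.measurable
    fun_prop
  · exact max_le zero_le_one (min_le_left _ _)

theorem Ups_le_of_density {c : Rd d → Rd d → ℝ}
    (hc : Measurable fun p : Rd d × Rd d => ENNReal.ofReal (c p.1 p.2)) {g : Rd d → ℝ}
    {h : Rd d × Rd d → ℝ≥0∞} (hh : Measurable h)
    (hfst : ∀ x, ∫⁻ y, h (x, y) = ENNReal.ofReal (g x))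
    (hsnd : ∀ y, ∫⁻ x, h (x, y) ≤ ENNReal.ofReal (1 - g y)) :
    Ups c g ≤ ∫⁻ p, h p * ENNReal.ofReal (c p.1 p.2) ∂(volume.prod volume) := by
  have hmem : (volume.prod volume).withDensity h ∈ ExtPlans g := by
    refine ⟨?_, ?_⟩
    · ext s hs
      rw [Measure.map_apply measurable_fst hs, withDensity_apply _ (measurable_fst hs), fMeas,
        withDensity_apply _ hs, ← prod_univ, ← Measure.prod_restrict, Measure.restrict_univ,
        lintegral_prod _ hh.aemeasurable]
      simp only [hfst]
    · refine Measure.le_iff.2 fun s hs => ?_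
      rw [Measure.map_apply measurable_snd hs, withDensity_apply _ (measurable_snd hs), fMeas,
        withDensity_apply _ hs, ← univ_prod, ← Measure.prod_restrict, Measure.restrict_univ,
        lintegral_prod_symm _ hh.aemeasurable]
      exact lintegral_mono fun y => hsnd y
  refine (iInf₂_le _ hmem).trans_eq ?_
  rw [planCost, lintegral_withDensity_eq_lintegral_mul _ hh hc]
  rfl

theorem exists_cells (hd : 1 ≤ d) {M : ℝ≥0∞} (hM : M ≠ ∞) :
    ∃ (q : Rd d → Fin d → ℤ) (R : ℝ), Measurable q ∧ (∀ x y, q x = q y → ‖y - x‖ ≤ R) ∧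
      (∀ x, M ≤ volume (q ⁻¹' {q x})) ∧ ∀ x, volume (q ⁻¹' {q x}) ≠ ∞ := by
  set s : ℝ := M.toReal + 1 with hs
  have hs1 : 1 ≤ s := by simp [hs]
  have hs0 : 0 < s := by linarith
  set q : Rd d → Fin d → ℤ := fun x i => ⌊x i / s⌋ with hq
  have hqm : Measurable q := by
    refine measurable_pi_lambda _ fun i => Int.measurable_floor.comp ?_
    fun_prop
  have hcell : ∀ z : Fin d → ℤ, q ⁻¹' {z} =
      (WithLp.ofLp : Rd d → Fin d → ℝ) ⁻¹'
        (Set.univ.pi fun i => Set.Ico (s * z i) (s * z i + s)) := by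
    intro z
    ext x
    simp only [hq, mem_preimage, mem_singleton_iff, funext_iff, mem_univ_pi, mem_Ico,
      Int.floor_eq_iff, le_div_iff₀ hs0, div_lt_iff₀ hs0]
    refine forall_congr' fun i => ?_
    constructor <;> rintro ⟨h1, h2⟩ <;> constructor <;> nlinarith
  have hvol : ∀ z : Fin d → ℤ, volume (q ⁻¹' {z}) = ENNReal.ofReal s ^ d := by
    intro z
    rw [hcell, (PiLp.volume_preserving_ofLp (Fin d)).measure_preimage
      (MeasurableSet.univ_pi fun i => measurableSet_Ico).nullMeasurableSet, Real.volume_pi_Ico]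
    simp
  refine ⟨q, √(∑ _i : Fin d, s ^ 2), hqm, ?_, ?_, ?_⟩
  · intro x y hxy
    rw [EuclideanSpace.norm_eq]
    refine Real.sqrt_le_sqrt (Finset.sum_le_sum fun i _ => ?_)
    have hi : ⌊x i / s⌋ = ⌊y i / s⌋ := congrFun hxy i
    have h1 := Int.abs_sub_lt_one_of_floor_eq_floor hi
    rw [← sub_div, abs_div, abs_of_pos hs0, div_lt_one hs0, abs_sub_comm] at h1
    rw [Real.norm_eq_abs]
    exact pow_le_pow_left₀ (abs_nonneg _) h1.le 2
  · intro x
    rw [hvol]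
    calc M = ENNReal.ofReal M.toReal := (ENNReal.ofReal_toReal hM).symm
      _ ≤ ENNReal.ofReal s := ENNReal.ofReal_le_ofReal (by simp [hs])
      _ ≤ _ := le_self_pow₀ (by simpa using hs1) (by omega)
  · intro x
    rw [hvol]
    exact ENNReal.pow_ne_top ENNReal.ofReal_ne_top

/-- Transport `u` into `v` inside each cell of a partition whose cells have enough capacity. -/
theorem exists_cell_density {α : Type*} [Countable α] [MeasurableSpace α]
    [MeasurableSingletonClass α]
    {q : Rd d → α} (hq : Measurable q) {M : ℝ≥0∞} (hM : M ≠ ∞)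
    (hvol : ∀ x, 3 * M + 1 ≤ volume (q ⁻¹' {q x})) (hfin : ∀ x, volume (q ⁻¹' {q x}) ≠ ∞)
    {u v w : Rd d → ℝ≥0∞} (hu : Measurable u) (hv : Measurable v)
    (hv1 : ∀ y, v y ≤ 1) (hvw : ∀ y, 1 ≤ v y + w y) (huM : ∫⁻ x, u x ≤ M)
    (hwM : ∫⁻ x, w x ≤ 2 * M) :
    ∃ h : Rd d × Rd d → ℝ≥0∞, Measurable h ∧ (∀ x y, q x ≠ q y → h (x, y) = 0) ∧
      (∀ x, ∫⁻ y, h (x, y) = u x) ∧ ∀ y, ∫⁻ x, h (x, y) ≤ v y := by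
  classical
  set V : α → ℝ≥0∞ := fun a => ∫⁻ y in q ⁻¹' {a}, v y with hV
  have hms : ∀ a, MeasurableSet (q ⁻¹' {a}) := fun a => hq (measurableSet_singleton a)
  have hVlow : ∀ x, M + 1 ≤ V (q x) := by
    intro x
    have h1 : volume (q ⁻¹' {q x}) ≤ V (q x) + 2 * M :=
      calc volume (q ⁻¹' {q x}) = ∫⁻ y in q ⁻¹' {q x}, 1 := by simp
        _ ≤ ∫⁻ y in q ⁻¹' {q x}, (v y + w y) := lintegral_mono fun y => hvw y
        _ = V (q x) + ∫⁻ y in q ⁻¹' {q x}, w y := lintegral_add_left hv _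
        _ ≤ V (q x) + 2 * M := by
          gcongr
          exact (setLIntegral_le_lintegral _ _).trans hwM
    have h2 : (M + 1) + 2 * M ≤ V (q x) + 2 * M := by
      refine le_trans (le_of_eq ?_) ((hvol x).trans h1)
      ring
    exact (ENNReal.add_le_add_iff_right (by finiteness)).1 h2
  have hVtop : ∀ x, V (q x) ≠ ∞ := fun x => by
    refine ne_top_of_le_ne_top (hfin x) ?_
    calc V (q x) ≤ ∫⁻ y in q ⁻¹' {q x}, 1 := lintegral_mono fun y => hv1 y
      _ = _ := by simp
  have hV0 : ∀ x, V (q x) ≠ 0 := fun x h0 => by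
    have := hVlow x
    simp [h0] at this
  have hVm : Measurable V := measurable_of_countable V
  set h : Rd d × Rd d → ℝ≥0∞ := fun p =>
    {p : Rd d × Rd d | q p.1 = q p.2}.indicator (fun p => u p.1 * (V (q p.1))⁻¹ * v p.2) p with hh
  have hE : MeasurableSet {p : Rd d × Rd d | q p.1 = q p.2} :=
    measurableSet_eq_fun (hq.comp measurable_fst) (hq.comp measurable_snd)
  refine ⟨h, ?_, ?_, ?_, ?_⟩
  · refine Measurable.indicator ?_ hE
    have := hVm.comp hq
    fun_prop
  · intro x y hxy
    simp [hh, hxy]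
  · intro x
    have : (fun y => h (x, y)) =
        (q ⁻¹' {q x}).indicator fun y => u x * (V (q x))⁻¹ * v y := by
      ext y
      by_cases hxy : q x = q y
      · simp [hh, hxy]
      · simp [hh, hxy, Ne.symm hxy]
    rw [this, lintegral_indicator (hms _), lintegral_const_mul _ hv, mul_assoc,
      ENNReal.inv_mul_cancel (hV0 x) (hVtop x), mul_one]
  · intro y
    have : (fun x => h (x, y)) =
        (q ⁻¹' {q y}).indicator fun x => ((V (q y))⁻¹ * v y) * u x := by
      ext x
      by_cases hxy : q x = q y
      · simp [hh, hxy]; ring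
      · simp [hh, hxy]
    rw [this, lintegral_indicator (hms _), lintegral_const_mul _ hu]
    have h1 : ∫⁻ x in q ⁻¹' {q y}, u x ≤ V (q y) :=
      (setLIntegral_le_lintegral _ _).trans (huM.trans (le_self_add.trans (hVlow y)))
    calc (V (q y))⁻¹ * v y * ∫⁻ x in q ⁻¹' {q y}, u x
        ≤ (V (q y))⁻¹ * v y * V (q y) := by gcongr
      _ = v y := by
        rw [mul_right_comm, ENNReal.inv_mul_cancel (hV0 y) (hVtop y), one_mul]

/-- A density whose marginals are dominated by `g` and `1 - g` can be completed to a plan, the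
missing mass being moved inside the cells of `q`, on which the cost is at most `C`. -/
theorem Ups_le_of_subdensity {c : Rd d → Rd d → ℝ}
    (hc : Measurable fun p : Rd d × Rd d => ENNReal.ofReal (c p.1 p.2))
    {α : Type*} [Countable α] [MeasurableSpace α] [MeasurableSingletonClass α]
    {q : Rd d → α} (hq : Measurable q) {M C : ℝ≥0∞} (hM : M ≠ ∞)
    (hvol : ∀ x, 3 * M + 1 ≤ volume (q ⁻¹' {q x})) (hfin : ∀ x, volume (q ⁻¹' {q x}) ≠ ∞)
    (hC : ∀ x y, q x = q y → ENNReal.ofReal (c x y) ≤ C)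
    {g : Rd d → ℝ} (hg : Measurable g) (hg01 : ∀ x, 0 ≤ g x ∧ g x ≤ 1)
    (hgM : ∫⁻ x, ENNReal.ofReal (g x) ≤ M)
    {h : Rd d × Rd d → ℝ≥0∞} (hh : Measurable h)
    (hfst : ∀ x, ∫⁻ y, h (x, y) ≤ ENNReal.ofReal (g x))
    (hsnd : ∀ y, ∫⁻ x, h (x, y) ≤ ENNReal.ofReal (1 - g y)) :
    Ups c g ≤ (∫⁻ p, h p * ENNReal.ofReal (c p.1 p.2) ∂(volume.prod volume)) +
      C * ((∫⁻ x, ENNReal.ofReal (g x)) - ∫⁻ p, h p ∂(volume.prod volume)) := by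
  set G : Rd d → ℝ≥0∞ := fun x => ENNReal.ofReal (g x) with hG
  set G' : Rd d → ℝ≥0∞ := fun x => ENNReal.ofReal (1 - g x) with hG'
  have hGm : Measurable G := hg.ennreal_ofReal
  have hGm' : Measurable G' := (measurable_const.sub hg).ennreal_ofReal
  have hsum : ∀ x, G x + G' x = 1 := fun x => by
    rw [hG, hG', ← ENNReal.ofReal_add (hg01 x).1 (by linarith [(hg01 x).2])]
    simp
  have hmx : Measurable fun x => ∫⁻ y, h (x, y) := hh.lintegral_prod_right'
  have hmy : Measurable fun y => ∫⁻ x, h (x, y) := hh.lintegral_prod_left'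
  have htot : ∫⁻ p, h p ∂(volume.prod volume) = ∫⁻ x, ∫⁻ y, h (x, y) :=
    lintegral_prod _ hh.aemeasurable
  have htot' : ∫⁻ p, h p ∂(volume.prod volume) = ∫⁻ y, ∫⁻ x, h (x, y) :=
    lintegral_prod_symm _ hh.aemeasurable
  have htotM : ∫⁻ p, h p ∂(volume.prod volume) ≤ M := by
    rw [htot]
    exact (lintegral_mono fun x => hfst x).trans hgM
  have hu : ∫⁻ x, (G x - ∫⁻ y, h (x, y)) =
      (∫⁻ x, G x) - ∫⁻ p, h p ∂(volume.prod volume) := by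
    rw [lintegral_sub hmx _ (ae_of_all _ hfst), htot]
    rw [← htot]
    exact ne_top_of_le_ne_top hM htotM
  obtain ⟨r, hr, hr0, hr1, hr2⟩ := exists_cell_density hq hM hvol hfin
    (u := fun x => G x - ∫⁻ y, h (x, y)) (v := fun y => G' y - ∫⁻ x, h (x, y))
    (w := fun y => G y + ∫⁻ x, h (x, y)) (hGm.sub hmx) (hGm'.sub hmy)
    (fun y => tsub_le_self.trans (le_add_self.trans (hsum y).le))
    (fun y => by
      rw [add_comm (G y), ← add_assoc, tsub_add_cancel_of_le (hsnd y), add_comm, hsum])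
    ((lintegral_mono fun x => tsub_le_self).trans hgM)
    (by
      rw [lintegral_add_left hGm, ← htot', two_mul]
      exact add_le_add hgM htotM)
  refine (Ups_le_of_density hc (h := fun p => h p + r p) (hh.add hr) ?_ ?_).trans ?_
  · intro x
    rw [lintegral_add_left (by fun_prop), hr1, add_tsub_cancel_of_le (hfst x)]
  · intro y
    rw [lintegral_add_left (by fun_prop)]
    calc _ ≤ (∫⁻ x, h (x, y)) + (G' y - ∫⁻ x, h (x, y)) := by gcongr; exact hr2 y
      _ = _ := add_tsub_cancel_of_le (hsnd y)
  · simp only [add_mul]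
    have hhc : Measurable fun p : Rd d × Rd d => h p * ENNReal.ofReal (c p.1 p.2) := hh.mul hc
    rw [lintegral_add_left hhc]
    gcongr
    calc ∫⁻ p, r p * ENNReal.ofReal (c p.1 p.2) ∂(volume.prod volume)
        ≤ ∫⁻ p, C * r p ∂(volume.prod volume) := by
          refine lintegral_mono fun p => ?_
          by_cases hp : q p.1 = q p.2
          · rw [mul_comm]
            gcongr
            exact hC _ _ hp
          · simp [show r p = 0 from hr0 _ _ hp]
      _ = C * ((∫⁻ x, G x) - ∫⁻ p, h p ∂(volume.prod volume)) := by
        rw [lintegral_const_mul _ hr, ← hu, lintegral_prod _ hr.aemeasurable]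
        simp only [hr1]

theorem mul_one_sub_mul_inv_max_le {a b : ℝ≥0∞} (ha : a ≠ ∞) (hb : b ≠ ∞) :
    a * (1 - b * (max a b)⁻¹) ≤ a - b := by
  rcases le_total a b with hab | hab
  · rw [max_eq_right hab]
    rcases eq_or_ne b 0 with rfl | hb0
    · simp [le_zero_iff.1 hab]
    · simp [ENNReal.mul_inv_cancel hb0 hb]
  · rw [max_eq_left hab, ENNReal.mul_sub (fun _ _ => ha), mul_one]
    rcases eq_or_ne a 0 with rfl | ha0
    · simp
    · rw [mul_left_comm, ENNReal.mul_inv_cancel ha0 ha, mul_one]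

theorem one_le_mul_add_one_sub {r t : ℝ≥0∞} (hr : r ≤ 1) (ht : t ≤ 1) :
    1 ≤ r * t + ((1 - r) + (1 - t)) :=
  calc (1 : ℝ≥0∞) = r * (t + (1 - t)) + (1 - r) := by
        rw [add_tsub_cancel_of_le ht, mul_one, add_tsub_cancel_of_le hr]
    _ = r * t + ((1 - r) + r * (1 - t)) := by ring
    _ ≤ _ := by
      gcongr
      exact mul_le_of_le_one_left' hr

/-- Transfer of a sub-plan with cell masses `a i j` bounded by the marginals `A i`, `B j` to a
density with cell masses close to `a i j` and marginals dominated by `G`, `G'`. -/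
theorem exists_transferred_density {ι : Type*} [Fintype ι] {G G' : Rd d → ℝ≥0∞}
    (hG : Measurable G) (hG' : Measurable G') {χ : ι → Rd d → ℝ≥0∞} (hχ : ∀ i, Measurable (χ i))
    (hχ1 : ∀ x, ∑ i, χ i x ≤ 1) {a : ι → ι → ℝ≥0∞} {A B : ι → ℝ≥0∞}
    (haA : ∀ i, ∑ j, a i j ≤ A i) (haB : ∀ j, ∑ i, a i j ≤ B j)
    (hA : ∀ i, A i ≠ ∞) (hB : ∀ j, B j ≠ ∞)
    (hGA : ∀ i, ∫⁻ x, χ i x * G x ≠ ∞) (hGB : ∀ j, ∫⁻ x, χ j x * G' x ≠ ∞)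
    {K : Rd d → Rd d → ℝ≥0∞} {κ : ι → ι → ℝ≥0∞}
    (hκ : ∀ i j x y, χ i x ≠ 0 → χ j y ≠ 0 → K x y ≤ κ i j) :
    ∃ h : Rd d × Rd d → ℝ≥0∞, Measurable h ∧ (∀ x, ∫⁻ y, h (x, y) ≤ G x) ∧
      (∀ y, ∫⁻ x, h (x, y) ≤ G' y) ∧
      (∫⁻ p, h p * K p.1 p.2 ∂(volume.prod volume) ≤ ∑ i, ∑ j, a i j * κ i j) ∧
      ∑ i, ∑ j, a i j ≤ (∫⁻ p, h p ∂(volume.prod volume)) +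
        ((∑ i, (A i - ∫⁻ x, χ i x * G x)) + ∑ j, (B j - ∫⁻ x, χ j x * G' x)) := by
  set A' : ι → ℝ≥0∞ := fun i => ∫⁻ x, χ i x * G x with hA'
  set B' : ι → ℝ≥0∞ := fun i => ∫⁻ x, χ i x * G' x with hB'
  set α : ι → ℝ≥0∞ := fun i => (max (A i) (A' i))⁻¹ with hα
  set β : ι → ℝ≥0∞ := fun i => (max (B i) (B' i))⁻¹ with hβ
  have hle : ∀ {s t : ℝ≥0∞}, s ≤ t → s * t⁻¹ ≤ 1 := fun h =>
    (mul_le_mul_left h _).trans (ENNReal.mul_inv_le_one _)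
  have hAα : ∀ i, A i * α i ≤ 1 := fun i => hle (le_max_left _ _)
  have hA'α : ∀ i, A' i * α i ≤ 1 := fun i => hle (le_max_right _ _)
  have hBβ : ∀ i, B i * β i ≤ 1 := fun i => hle (le_max_left _ _)
  have hB'β : ∀ i, B' i * β i ≤ 1 := fun i => hle (le_max_right _ _)
  have hmG : ∀ i, Measurable fun x => χ i x * G x := fun i => (hχ i).mul hG
  have hmG' : ∀ i, Measurable fun x => χ i x * G' x := fun i => (hχ i).mul hG'
  set t : ι → ι → Rd d × Rd d → ℝ≥0∞ := fun i j p =>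
    a i j * α i * β j * ((χ i p.1 * G p.1) * (χ j p.2 * G' p.2)) with ht
  have hmm : ∀ i j, Measurable fun p : Rd d × Rd d =>
      (χ i p.1 * G p.1) * (χ j p.2 * G' p.2) := fun i j =>
    ((hmG i).comp measurable_fst).mul ((hmG' j).comp measurable_snd)
  have htm : ∀ i j, Measurable (t i j) := fun i j => (hmm i j).const_mul _
  have htint : ∀ i j, ∫⁻ p, t i j p ∂(volume.prod volume) =
      a i j * ((A' i * α i) * (B' j * β j)) := fun i j => by
    simp only [ht]
    rw [lintegral_const_mul _ (hmm i j),
      lintegral_prod_mul (hmG i).aemeasurable (hmG' j).aemeasurable]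
    ring
  have hhm : Measurable fun p => ∑ i, ∑ j, t i j p :=
    Finset.measurable_fun_sum _ fun i _ => Finset.measurable_fun_sum _ fun j _ => htm i j
  refine ⟨fun p => ∑ i, ∑ j, t i j p, hhm, fun x => ?_, fun y => ?_, ?_, ?_⟩
  · have h1 : ∀ i j, ∫⁻ y, t i j (x, y) = a i j * (α i * (χ i x * G x)) * (B' j * β j) :=
      fun i j => by
        simp only [ht]
        rw [lintegral_const_mul _ ((hmG' j).const_mul _), lintegral_const_mul _ (hmG' j)]
        ring
    have h2 : ∀ i j, Measurable fun y => t i j (x, y) := fun i j =>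
      (htm i j).comp measurable_prodMk_left
    have h3 : ∫⁻ y, ∑ i, ∑ j, t i j (x, y) = ∑ i, ∫⁻ y, ∑ j, t i j (x, y) :=
      lintegral_finsetSum _ fun i _ => Finset.measurable_fun_sum _ fun j _ => h2 i j
    refine h3.trans_le ?_
    calc ∑ i, ∫⁻ y, ∑ j, t i j (x, y) = ∑ i, ∑ j, a i j * (α i * (χ i x * G x)) * (B' j * β j) := by
          refine Finset.sum_congr rfl fun i _ => ?_
          rw [lintegral_finsetSum _ fun j _ => h2 i j]
          simp only [h1]
      _ ≤ ∑ i, ∑ j, a i j * (α i * (χ i x * G x)) := by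
        exact Finset.sum_le_sum fun i _ => Finset.sum_le_sum fun j _ =>
          mul_le_of_le_one_right' (hB'β j)
      _ ≤ ∑ i, χ i x * G x := by
        gcongr with i _
        rw [← Finset.sum_mul]
        calc _ ≤ A i * (α i * (χ i x * G x)) := by gcongr; exact haA i
          _ = (A i * α i) * (χ i x * G x) := by ring
          _ ≤ _ := mul_le_of_le_one_left' (hAα i)
      _ ≤ G x := by
        rw [← Finset.sum_mul]
        exact mul_le_of_le_one_left' (hχ1 x)
  · have h1 : ∀ i j, ∫⁻ x, t i j (x, y) = a i j * (β j * (χ j y * G' y)) * (A' i * α i) :=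
      fun i j => by
        simp only [ht]
        rw [lintegral_const_mul _ ((hmG i).mul_const _), lintegral_mul_const _ (hmG i)]
        ring
    have h2 : ∀ i j, Measurable fun x => t i j (x, y) := fun i j =>
      (htm i j).comp measurable_prodMk_right
    have h3 : ∫⁻ x, ∑ i, ∑ j, t i j (x, y) = ∑ i, ∫⁻ x, ∑ j, t i j (x, y) :=
      lintegral_finsetSum _ fun i _ => Finset.measurable_fun_sum _ fun j _ => h2 i j
    refine h3.trans_le ?_
    calc ∑ i, ∫⁻ x, ∑ j, t i j (x, y) =
          ∑ i, ∑ j, a i j * (β j * (χ j y * G' y)) * (A' i * α i) := by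
          refine Finset.sum_congr rfl fun i _ => ?_
          rw [lintegral_finsetSum _ fun j _ => h2 i j]
          simp only [h1]
      _ ≤ ∑ i, ∑ j, a i j * (β j * (χ j y * G' y)) := by
        exact Finset.sum_le_sum fun i _ => Finset.sum_le_sum fun j _ =>
          mul_le_of_le_one_right' (hA'α i)
      _ ≤ ∑ j, χ j y * G' y := by
        rw [Finset.sum_comm]
        gcongr with j _
        rw [← Finset.sum_mul]
        calc _ ≤ B j * (β j * (χ j y * G' y)) := by gcongr; exact haB j
          _ = (B j * β j) * (χ j y * G' y) := by ring
          _ ≤ _ := mul_le_of_le_one_left' (hBβ j)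
      _ ≤ G' y := by
        rw [← Finset.sum_mul]
        exact mul_le_of_le_one_left' (hχ1 y)
  · calc ∫⁻ p, (∑ i, ∑ j, t i j p) * K p.1 p.2 ∂(volume.prod volume)
        ≤ ∫⁻ p, ∑ i, ∑ j, κ i j * t i j p ∂(volume.prod volume) := by
          refine lintegral_mono fun p => ?_
          rw [Finset.sum_mul]
          simp only [Finset.sum_mul]
          refine Finset.sum_le_sum fun i _ => Finset.sum_le_sum fun j _ => ?_
          by_cases h1 : χ i p.1 = 0
          · simp [ht, h1]
          by_cases h2 : χ j p.2 = 0
          · simp [ht, h2]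
          rw [mul_comm]
          gcongr
          exact hκ i j _ _ h1 h2
      _ = ∑ i, ∑ j, κ i j * (a i j * ((A' i * α i) * (B' j * β j))) := by
        rw [lintegral_finsetSum _ fun i _ => Finset.measurable_fun_sum _ fun j _ =>
          (htm i j).const_mul _]
        refine Finset.sum_congr rfl fun i _ => ?_
        rw [lintegral_finsetSum _ fun j _ => (htm i j).const_mul _]
        refine Finset.sum_congr rfl fun j _ => ?_
        rw [lintegral_const_mul _ (htm i j), htint]
      _ ≤ ∑ i, ∑ j, a i j * κ i j := by
        refine Finset.sum_le_sum fun i _ => Finset.sum_le_sum fun j _ => ?_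
        rw [mul_comm]
        gcongr
        exact mul_le_of_le_one_right' (mul_le_one' (hA'α i) (hB'β j))
  · have hintegral : ∫⁻ p, ∑ i, ∑ j, t i j p ∂(volume.prod volume) =
        ∑ i, ∑ j, a i j * ((A' i * α i) * (B' j * β j)) := by
      rw [lintegral_finsetSum _ fun i _ => Finset.measurable_fun_sum _ fun j _ => htm i j]
      refine Finset.sum_congr rfl fun i _ => ?_
      rw [lintegral_finsetSum _ fun j _ => htm i j]
      simp only [htint]
    rw [hintegral]
    calc ∑ i, ∑ j, a i j
        ≤ ∑ i, ∑ j, (a i j * ((A' i * α i) * (B' j * β j)) +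
            (a i j * (1 - A' i * α i) + a i j * (1 - B' j * β j))) := by
          gcongr with i _ j _
          rw [← mul_add, ← mul_add]
          exact le_mul_of_one_le_right' (one_le_mul_add_one_sub (hA'α i) (hB'β j))
      _ = ∑ i, ∑ j, a i j * ((A' i * α i) * (B' j * β j)) +
          (∑ i, (∑ j, a i j) * (1 - A' i * α i) + ∑ j, (∑ i, a i j) * (1 - B' j * β j)) := by
        simp only [Finset.sum_add_distrib, Finset.sum_mul]
        congr 2
        exact Finset.sum_comm
      _ ≤ _ := by
        gcongr with i _ j _
        · exact (mul_le_mul_left (haA i) _).trans (mul_one_sub_mul_inv_max_le (hA i) (hGA i))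
        · exact (mul_le_mul_left (haB j) _).trans (mul_one_sub_mul_inv_max_le (hB j) (hGB j))

/-- Quantitative comparison of `Ups c g` with the cost of a plan for `f`, in terms of the
integrals of `f` and `g` against a partition of unity `χ` adapted to the cost. -/
theorem Ups_le_planCost_add {c : Rd d → Rd d → ℝ}
    (hc : Measurable fun p : Rd d × Rd d => ENNReal.ofReal (c p.1 p.2))
    {α : Type*} [Countable α] [MeasurableSpace α] [MeasurableSingletonClass α]
    {q : Rd d → α} (hq : Measurable q) {M C ε : ℝ≥0∞} (hM : M ≠ ∞)
    (hvol : ∀ x, 3 * M + 1 ≤ volume (q ⁻¹' {q x})) (hfin : ∀ x, volume (q ⁻¹' {q x}) ≠ ∞)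
    (hC : ∀ x y, q x = q y → ENNReal.ofReal (c x y) ≤ C)
    {f g : Rd d → ℝ} (hf : Measurable f) (hf01 : ∀ x, 0 ≤ f x ∧ f x ≤ 1)
    (hg : Measurable g) (hg01 : ∀ x, 0 ≤ g x ∧ g x ≤ 1)
    (hfM : ∫⁻ x, ENNReal.ofReal (f x) ≤ M) (hgM : ∫⁻ x, ENNReal.ofReal (g x) ≤ M)
    {γ : Measure (Rd d × Rd d)} (hγ : γ ∈ ExtPlans f)
    {ι : Type*} [Fintype ι] {χ : ι → Rd d → ℝ≥0∞} (hχ : ∀ i, Measurable (χ i))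
    (hχ1 : ∀ x, ∑ i, χ i x ≤ 1) (hχfin : ∀ i, ∫⁻ x, χ i x ≠ ∞) {κ : ι → ι → ℝ≥0∞}
    (hκ : ∀ i j x y, χ i x ≠ 0 → χ j y ≠ 0 →
      ENNReal.ofReal (c x y) ≤ κ i j ∧ κ i j ≤ ENNReal.ofReal (c x y) + ε) :
    Ups c g ≤ planCost c γ + ε * M +
      C * (((∫⁻ x, ENNReal.ofReal (g x)) - ∫⁻ x, ENNReal.ofReal (f x)) +
        ((∑ i, ((∫⁻ x, χ i x * ENNReal.ofReal (f x)) - ∫⁻ x, χ i x * ENNReal.ofReal (g x))) +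
          ∑ i, ((∫⁻ x, χ i x * ENNReal.ofReal (g x)) - ∫⁻ x, χ i x * ENNReal.ofReal (f x))) +
        ∫⁻ p, ((1 - ∑ i, χ i p.1) + (1 - ∑ i, χ i p.2)) ∂γ) := by
  have hfst : ∀ {φ : Rd d → ℝ≥0∞}, Measurable φ →
      ∫⁻ p, φ p.1 ∂γ = ∫⁻ x, φ x * ENNReal.ofReal (f x) := fun {φ} hφ => by
    rw [← lintegral_map hφ measurable_fst, hγ.1, fMeas,
      lintegral_withDensity_eq_lintegral_mul _ hf.ennreal_ofReal hφ]
    simp only [Pi.mul_apply, mul_comm]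
  have hsnd : ∀ {φ : Rd d → ℝ≥0∞}, Measurable φ →
      ∫⁻ p, φ p.2 ∂γ ≤ ∫⁻ x, φ x * ENNReal.ofReal (1 - f x) := fun {φ} hφ => by
    rw [← lintegral_map hφ measurable_snd]
    refine (lintegral_mono' hγ.2 le_rfl).trans_eq ?_
    rw [fMeas, lintegral_withDensity_eq_lintegral_mul _ (hf.const_sub 1).ennreal_ofReal hφ]
    simp only [Pi.mul_apply, mul_comm]
  have hmass : γ univ = ∫⁻ x, ENNReal.ofReal (f x) := by
    simpa using hfst (φ := fun _ => 1) measurable_const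
  have hle1 : ∀ {u : Rd d → ℝ}, (∀ x, u x ≤ 1) → ∀ i,
      ∫⁻ x, χ i x * ENNReal.ofReal (u x) ≠ ∞ := fun hu i =>
    ne_top_of_le_ne_top (hχfin i) <| lintegral_mono fun x =>
      mul_le_of_le_one_right' (ENNReal.ofReal_le_one.2 (hu x))
  have hcompl : ∀ {u : Rd d → ℝ}, Measurable u → (∀ x, 0 ≤ u x ∧ u x ≤ 1) → ∀ i,
      (∫⁻ x, χ i x * ENNReal.ofReal (u x)) + (∫⁻ x, χ i x * ENNReal.ofReal (1 - u x)) =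
        ∫⁻ x, χ i x := fun {u} hu hu1 i => by
    have hm : Measurable fun x => χ i x * ENNReal.ofReal (u x) := (hχ i).mul hu.ennreal_ofReal
    rw [← lintegral_add_left hm]
    refine lintegral_congr fun x => ?_
    rw [← mul_add, ← ENNReal.ofReal_add (hu1 x).1 (by linarith [(hu1 x).2])]
    simp
  have hmχ : ∀ i j, Measurable fun p : Rd d × Rd d => χ i p.1 * χ j p.2 := fun i j =>
    ((hχ i).comp measurable_fst).mul ((hχ j).comp measurable_snd)
  set a : ι → ι → ℝ≥0∞ := fun i j => ∫⁻ p, χ i p.1 * χ j p.2 ∂γ with ha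
  obtain ⟨h, hh, h1, h2, h3, h4⟩ := exists_transferred_density (a := a)
    (A := fun i => ∫⁻ x, χ i x * ENNReal.ofReal (f x))
    (B := fun i => ∫⁻ x, χ i x * ENNReal.ofReal (1 - f x))
    hg.ennreal_ofReal (hg.const_sub 1).ennreal_ofReal hχ hχ1
    (fun i => by
      simp only [ha]
      rw [← lintegral_finsetSum _ fun j _ => hmχ i j, ← hfst (hχ i)]
      refine lintegral_mono fun p => ?_
      rw [← Finset.mul_sum]
      exact mul_le_of_le_one_right' (hχ1 _))
    (fun j => by
      simp only [ha]
      rw [← lintegral_finsetSum _ fun i _ => hmχ i j]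
      refine le_trans ?_ (hsnd (hχ j))
      refine lintegral_mono fun p => ?_
      rw [← Finset.sum_mul]
      exact mul_le_of_le_one_left' (hχ1 _))
    (hle1 fun x => (hf01 x).2) (hle1 fun x => by linarith [(hf01 x).1])
    (hle1 fun x => (hg01 x).2) (hle1 fun x => by linarith [(hg01 x).1])
    (K := fun x y => ENNReal.ofReal (c x y)) (κ := κ)
    fun i j x y hx hy => (hκ i j x y hx hy).1
  refine (Ups_le_of_subdensity hc hq hM hvol hfin hC hg hg01 hgM hh h1 h2).trans ?_
  refine add_le_add (h3.trans ?_) ?_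
  · calc ∑ i, ∑ j, a i j * κ i j
        = ∫⁻ p, ∑ i, ∑ j, χ i p.1 * χ j p.2 * κ i j ∂γ := by
          rw [lintegral_finsetSum _ fun i _ => Finset.measurable_fun_sum _ fun j _ =>
            (hmχ i j).mul_const _]
          refine Finset.sum_congr rfl fun i _ => ?_
          rw [lintegral_finsetSum _ fun j _ => (hmχ i j).mul_const _]
          refine Finset.sum_congr rfl fun j _ => ?_
          rw [lintegral_mul_const _ (hmχ i j)]
      _ ≤ ∫⁻ p, (ENNReal.ofReal (c p.1 p.2) + ε) ∂γ := by
        refine lintegral_mono fun p => ?_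
        calc ∑ i, ∑ j, χ i p.1 * χ j p.2 * κ i j
            ≤ ∑ i, ∑ j, χ i p.1 * χ j p.2 * (ENNReal.ofReal (c p.1 p.2) + ε) := by
              refine Finset.sum_le_sum fun i _ => Finset.sum_le_sum fun j _ => ?_
              by_cases hx : χ i p.1 = 0
              · simp [hx]
              by_cases hy : χ j p.2 = 0
              · simp [hy]
              gcongr
              exact (hκ i j _ _ hx hy).2
          _ = (∑ i, χ i p.1) * (∑ j, χ j p.2) * (ENNReal.ofReal (c p.1 p.2) + ε) := by
            rw [Finset.sum_mul_sum, Finset.sum_mul]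
            simp only [Finset.sum_mul]
          _ ≤ _ := mul_le_of_le_one_left' (mul_le_one' (hχ1 _) (hχ1 _))
      _ = planCost c γ + ε * γ univ := by
        rw [lintegral_add_left hc, lintegral_const, planCost]
      _ ≤ _ := by
        gcongr
        exact hmass.trans_le hfM
  · gcongr
    have hsumχ : Measurable fun x => ∑ i, χ i x :=
      Finset.measurable_fun_sum _ fun i _ => hχ i
    have hout : ∫⁻ x, ENNReal.ofReal (f x) ≤ (∑ i, ∑ j, a i j) +
        ∫⁻ p, ((1 - ∑ i, χ i p.1) + (1 - ∑ i, χ i p.2)) ∂γ := by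
      have hsum : ∑ i, ∑ j, a i j = ∫⁻ p, (∑ i, χ i p.1) * ∑ j, χ j p.2 ∂γ := by
        simp only [Finset.sum_mul_sum]
        rw [lintegral_finsetSum _ fun i _ => Finset.measurable_fun_sum _ fun j _ => hmχ i j]
        refine Finset.sum_congr rfl fun i _ => ?_
        rw [lintegral_finsetSum _ fun j _ => hmχ i j]
      have hm : Measurable fun p : Rd d × Rd d => (∑ i, χ i p.1) * ∑ j, χ j p.2 :=
        (hsumχ.comp measurable_fst).mul (hsumχ.comp measurable_snd)
      rw [hsum, ← lintegral_add_left hm, ← hmass, ← lintegral_one]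
      exact lintegral_mono fun p => one_le_mul_add_one_sub (hχ1 _) (hχ1 _)
    have hB : ∑ j, ((∫⁻ x, χ j x * ENNReal.ofReal (1 - f x)) -
        ∫⁻ x, χ j x * ENNReal.ofReal (1 - g x)) ≤
        ∑ j, ((∫⁻ x, χ j x * ENNReal.ofReal (g x)) - ∫⁻ x, χ j x * ENNReal.ofReal (f x)) := by
      refine Finset.sum_le_sum fun j _ => ?_
      rw [tsub_le_iff_right, ← ENNReal.add_le_add_iff_left (hle1 (fun x => (hf01 x).2) j),
        hcompl hf hf01, ← hcompl hg hg01 j, ← add_assoc]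
      gcongr
      exact le_add_tsub
    rw [tsub_le_iff_right]
    refine (le_tsub_add (a := ∫⁻ x, ENNReal.ofReal (f x))).trans ?_
    rw [add_assoc, add_assoc]
    gcongr
    refine hout.trans ((add_le_add_left
      (h4.trans (add_le_add_right (add_le_add_right hB _) _)) _).trans_eq ?_)
    ring

open Metric in
theorem exists_cost_partition {k : Rd d → ℝ} (hk : Continuous k) (ρ : ℝ) {ε : ℝ} (hε : 0 < ε) :
    ∃ (ι : Type) (_ : Fintype ι) (χ : ι → BoundedContinuousFunction (Rd d) ℝ)
      (κ : ι → ι → ℝ≥0∞), (∀ i x, 0 ≤ χ i x) ∧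
      (∀ x, ∑ i, ENNReal.ofReal (χ i x) ≤ 1) ∧
      (∀ x, ‖x‖ ≤ ρ → ∑ i, ENNReal.ofReal (χ i x) = 1) ∧
      (∀ i, ∫⁻ x, ENNReal.ofReal (χ i x) ≠ ∞) ∧
      ∀ i j x y, ENNReal.ofReal (χ i x) ≠ 0 → ENNReal.ofReal (χ j y) ≠ 0 →
        ENNReal.ofReal (k (y - x)) ≤ κ i j ∧
        κ i j ≤ ENNReal.ofReal (k (y - x)) + ENNReal.ofReal ε := by
  obtain ⟨δ, hδ, hkδ⟩ := Metric.uniformContinuousOn_iff.1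
    ((isCompact_closedBall (0 : Rd d) (2 * ρ + 2)).uniformContinuousOn_of_continuous
      hk.continuousOn) (ε / 2) (half_pos hε)
  set η : ℝ := min 1 (δ / 2) with hη
  have hη0 : 0 < η := lt_min one_pos (half_pos hδ)
  have hη1 : η ≤ 1 := min_le_left _ _
  have hηδ : 2 * η ≤ δ := by linarith [min_le_right 1 (δ / 2)]
  obtain ⟨n, z, hz, hcover⟩ : ∃ (n : ℕ) (z : Fin n → Rd d), (∀ i, ‖z i‖ ≤ ρ) ∧
      closedBall (0 : Rd d) ρ ⊆ ⋃ i, ball (z i) η := by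
    obtain ⟨t, hts, htf, htc⟩ := (isCompact_closedBall (0 : Rd d) ρ).finite_cover_balls hη0
    have := htf.fintype
    let e := Fintype.equivFin t
    refine ⟨Fintype.card t, fun i => (e.symm i : Rd d), fun i => ?_, fun x hx => ?_⟩
    · simpa using hts (e.symm i).2
    · obtain ⟨y, hy, hxy⟩ := mem_iUnion₂.1 (htc hx)
      exact mem_iUnion.2 ⟨e ⟨y, hy⟩, by simpa using hxy⟩
  obtain ⟨P, hP⟩ := PartitionOfUnity.exists_isSubordinate isClosed_closedBall
    (fun i => ball (z i) η) (fun i => isOpen_ball) hcover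
  have hball : ∀ i x, ENNReal.ofReal (P i x) ≠ 0 → ‖x - z i‖ < η := fun i x hx => by
    rw [← dist_eq_norm, ← mem_ball]
    refine hP i (subset_tsupport _ ?_)
    intro h0
    exact hx (by simp [h0])
  have hsum : ∀ x, ∑ i, ENNReal.ofReal (P i x) = ENNReal.ofReal (∑ᶠ i, P i x) := fun x => by
    rw [finsum_eq_sum_of_fintype, ENNReal.ofReal_sum_of_nonneg fun i _ => P.nonneg i x]
  refine ⟨Fin n, inferInstance, fun i => BoundedContinuousFunction.ofNormedAddCommGroup (P i)
    (P i).continuous 1 fun x => ?_, fun i j => ENNReal.ofReal (k (z j - z i) + ε / 2),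
    fun i x => P.nonneg i x, fun x => ?_, fun x hx => ?_, fun i => ?_, fun i j x y hx hy => ?_⟩
  · rw [Real.norm_eq_abs, abs_of_nonneg (P.nonneg i x)]
    exact P.le_one i x
  · exact (hsum x).trans_le (ENNReal.ofReal_le_one.2 (P.sum_le_one x))
  · refine (hsum x).trans ?_
    rw [P.sum_eq_one (by simpa using hx), ENNReal.ofReal_one]
  · refine ne_top_of_le_ne_top (measure_ball_lt_top (μ := volume) (x := z i) (r := η)).ne ?_
    rw [← lintegral_indicator_one measurableSet_ball]
    refine lintegral_mono fun x => ?_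
    by_cases hx : ENNReal.ofReal (P i x) = 0
    · exact hx.trans_le zero_le
    · have : x ∈ ball (z i) η := by simpa [dist_eq_norm] using hball i x hx
      simp only [indicator_of_mem this]
      exact ENNReal.ofReal_le_one.2 (P.le_one i x)
  · have h1 := hball i x hx
    have h2 := hball j y hy
    have h3 : ‖(y - x) - (z j - z i)‖ < δ :=
      calc ‖(y - x) - (z j - z i)‖ = ‖(y - z j) - (x - z i)‖ := by congr 1; abel
        _ ≤ ‖y - z j‖ + ‖x - z i‖ := norm_sub_le _ _
        _ < δ := by linarith
    have h4 : ‖z j - z i‖ ≤ 2 * ρ := by linarith [norm_sub_le (z j) (z i), hz i, hz j]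
    have h5 : ‖y - x‖ ≤ 2 * ρ + 2 :=
      calc ‖y - x‖ = ‖(y - z j) - (x - z i) + (z j - z i)‖ := by congr 1; abel
        _ ≤ ‖y - z j‖ + ‖x - z i‖ + ‖z j - z i‖ :=
          (norm_add_le _ _).trans (add_le_add_left (norm_sub_le _ _) _)
        _ ≤ _ := by linarith
    have h6 := hkδ (y - x) (by simpa using h5) (z j - z i) (by simp; linarith)
      (by rwa [dist_eq_norm])
    rw [Real.dist_eq, abs_lt] at h6
    refine ⟨ENNReal.ofReal_le_ofReal (by linarith [h6.2]), ?_⟩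
    calc ENNReal.ofReal (k (z j - z i) + ε / 2) ≤ ENNReal.ofReal (k (y - x) + ε) :=
          ENNReal.ofReal_le_ofReal (by linarith [h6.1])
      _ ≤ _ := ENNReal.ofReal_add_le

/-- Tail estimate for a plan of bounded cost whose first marginal has a small tail. -/
theorem lintegral_tail_le {k : Rd d → ℝ} (hk : Continuous k) {f : Rd d → ℝ}
    {γ : Measure (Rd d × Rd d)} (hγ : γ ∈ ExtPlans f) {r R : ℝ} (hR : 0 ≤ R) {Λ e L : ℝ≥0∞}
    (htail : fMeas f (Metric.closedBall 0 r)ᶜ ≤ e)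
    (hΛ : ∀ z, R < ‖z‖ → Λ ≤ ENNReal.ofReal (k z)) (hΛ0 : Λ ≠ 0) (hΛt : Λ ≠ ∞)
    (hL : planCost (transCost k) γ ≤ L) (hLe : L ≤ e * Λ)
    {φ : Rd d → ℝ≥0∞} (hφ : ∀ x, φ x ≤ 1) (hφ0 : ∀ x, ‖x‖ ≤ r + R → φ x = 0) :
    ∫⁻ p, (φ p.1 + φ p.2) ∂γ ≤ 3 * e := by
  set S : Set (Rd d × Rd d) := Prod.fst ⁻¹' (Metric.closedBall 0 r)ᶜ with hS
  set T : Set (Rd d × Rd d) := {p | Λ ≤ ENNReal.ofReal (k (p.2 - p.1))} with hT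
  have hSm : MeasurableSet S := measurable_fst Metric.isClosed_closedBall.measurableSet.compl
  have hkm : Measurable fun p : Rd d × Rd d => ENNReal.ofReal (k (p.2 - p.1)) := by
    have : Continuous fun p : Rd d × Rd d => k (p.2 - p.1) := by fun_prop
    exact this.measurable.ennreal_ofReal
  have hTm : MeasurableSet T := measurableSet_le measurable_const hkm
  have hSe : γ S ≤ e := by
    rw [hS, ← Measure.map_apply measurable_fst
      Metric.isClosed_closedBall.measurableSet.compl, hγ.1]
    exact htail
  have hTe : γ T ≤ e := by
    refine (meas_ge_le_lintegral_div hkm.aemeasurable hΛ0 hΛt).trans ?_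
    exact ENNReal.div_le_of_le_mul (le_trans hL hLe)
  have hpt : ∀ p : Rd d × Rd d, φ p.1 + φ p.2 ≤
      (S.indicator 1 p + S.indicator 1 p) + T.indicator 1 p := by
    intro p
    by_cases hp : p ∈ S
    · simp only [indicator_of_mem hp]
      exact (add_le_add (hφ _) (hφ _)).trans le_self_add
    · have hp1 : ‖p.1‖ ≤ r := by simpa [hS] using hp
      rw [hφ0 p.1 (by linarith), zero_add]
      by_cases hq : p ∈ T
      · simp only [indicator_of_mem hq]
        exact (hφ _).trans le_add_self
      · have hp2 : ‖p.2 - p.1‖ ≤ R := by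
          by_contra! hlt
          exact hq (hΛ _ hlt)
        have : ‖p.2‖ ≤ r + R := by
          calc ‖p.2‖ = ‖p.1 + (p.2 - p.1)‖ := by congr 1; abel
            _ ≤ _ := (norm_add_le _ _).trans (add_le_add hp1 hp2)
        rw [hφ0 p.2 this]
        exact zero_le
  have hSi : Measurable (S.indicator (1 : Rd d × Rd d → ℝ≥0∞)) := measurable_one.indicator hSm
  have hSS : Measurable fun p => S.indicator (1 : Rd d × Rd d → ℝ≥0∞) p + S.indicator 1 p :=
    hSi.add hSi
  calc ∫⁻ p, (φ p.1 + φ p.2) ∂γ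
      ≤ ∫⁻ p, ((S.indicator 1 p + S.indicator 1 p) + T.indicator 1 p) ∂γ := lintegral_mono hpt
    _ = γ S + γ S + γ T := by
      rw [lintegral_add_left hSS, lintegral_add_left hSi, lintegral_indicator_one hSm,
        lintegral_indicator_one hTm]
    _ ≤ e + e + e := by gcongr
    _ = 3 * e := by ring

/-- Discrepancy between `f` and `g` measured by total mass and finitely many test functions. -/
def testGap {ι : Type*} [Fintype ι] (χ : ι → Rd d → ℝ≥0∞) (f g : Rd d → ℝ) : ℝ≥0∞ :=
  ((∫⁻ x, ENNReal.ofReal (g x)) - ∫⁻ x, ENNReal.ofReal (f x)) +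
    ((∑ i, ((∫⁻ x, χ i x * ENNReal.ofReal (f x)) - ∫⁻ x, χ i x * ENNReal.ofReal (g x))) +
      ∑ i, ((∫⁻ x, χ i x * ENNReal.ofReal (g x)) - ∫⁻ x, χ i x * ENNReal.ofReal (f x)))

theorem exists_Ups_modulus (hd : 1 ≤ d) {k : Rd d → ℝ} (h1 : H1 k) {M : ℝ≥0∞} (hM : M ≠ ∞) :
    ∃ C : ℝ≥0∞, C ≠ ∞ ∧ (∀ g : Rd d → ℝ, Measurable g → InUnit g →
      ∫⁻ x, ENNReal.ofReal (g x) ≤ M → Ups (transCost k) g ≤ C * M) ∧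
      ∀ e : ℝ≥0∞, e ≠ 0 → e ≤ 1 → ∀ r : ℝ,
      ∃ (ι : Type) (_ : Fintype ι) (χ : ι → BoundedContinuousFunction (Rd d) ℝ),
        (∀ i x, 0 ≤ χ i x) ∧ ∀ f g : Rd d → ℝ, Measurable f → Measurable g → InUnit f →
          InUnit g → ∫⁻ x, ENNReal.ofReal (f x) ≤ M → ∫⁻ x, ENNReal.ofReal (g x) ≤ M →
          fMeas f (Metric.closedBall 0 r)ᶜ ≤ e →
          Ups (transCost k) g ≤ Ups (transCost k) f + e * (1 + M + C * 3) +
            C * testGap (fun i x => ENNReal.ofReal (χ i x)) f g := by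
  obtain ⟨hk, -, hinf⟩ := h1
  have hc : Measurable fun p : Rd d × Rd d => ENNReal.ofReal (transCost k p.1 p.2) := by
    have : Continuous fun p : Rd d × Rd d => transCost k p.1 p.2 := by
      unfold transCost
      fun_prop
    exact this.measurable.ennreal_ofReal
  obtain ⟨q, R₀, hq, hqR, hvol, hfin⟩ := exists_cells hd (M := 3 * M + 1) (by finiteness)
  obtain ⟨C, hC⟩ := (isCompact_closedBall (0 : Rd d) R₀).bddAbove_image hk.continuousOn
  have hCq : ∀ x y, q x = q y → ENNReal.ofReal (transCost k x y) ≤ ENNReal.ofReal C :=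
    fun x y hxy => ENNReal.ofReal_le_ofReal
      (hC (mem_image_of_mem k (by simpa using hqR x y hxy)))
  have hbound : ∀ g : Rd d → ℝ, Measurable g → InUnit g →
      ∫⁻ x, ENNReal.ofReal (g x) ≤ M → Ups (transCost k) g ≤ ENNReal.ofReal C * M := by
    intro g hg hg1 hgM
    refine (Ups_le_of_subdensity hc hq hM hvol hfin hCq hg hg1.2 hgM (h := 0)
      measurable_zero (by simp) (by simp)).trans ?_
    simpa using mul_le_mul_right hgM _
  refine ⟨ENNReal.ofReal C, ENNReal.ofReal_ne_top, hbound, fun e he0 he1 r => ?_⟩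
  have het : e ≠ ∞ := ne_top_of_le_ne_top one_ne_top he1
  set L : ℝ≥0∞ := ENNReal.ofReal C * M + 1 with hLdef
  have hLt : L ≠ ∞ := by finiteness
  set Λ : ℝ := (L / e).toReal + 1 with hΛdef
  have hΛ0 : 0 < Λ := by positivity
  obtain ⟨R, hR0, hR⟩ : ∃ R : ℝ, 0 ≤ R ∧ ∀ z, R < ‖z‖ → Λ ≤ k z := by
    have h := hinf.eventually_ge_atTop Λ
    rw [← comap_norm_atTop, eventually_comap] at h
    obtain ⟨R, hR⟩ := eventually_atTop.1 h
    exact ⟨max R 0, le_max_right _ _, fun z hz =>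
      hR ‖z‖ ((le_max_left _ _).trans hz.le) z rfl⟩
  have hLe : L ≤ e * ENNReal.ofReal Λ := by
    have hLe' : L / e ≠ ∞ := ENNReal.div_ne_top hLt he0
    rw [← ENNReal.div_le_iff' he0 het, ← ENNReal.ofReal_toReal hLe']
    exact ENNReal.ofReal_le_ofReal (by linarith)
  obtain ⟨ι, _, χ, κ, hχ0, hχ1, hχρ, hχfin, hκ⟩ :=
    exists_cost_partition hk (r + R) (ENNReal.toReal_pos he0 het)
  rw [ENNReal.ofReal_toReal het] at hκ
  refine ⟨ι, inferInstance, χ, hχ0, fun f g hf hg hf1 hg1 hfM hgM htail => ?_⟩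
  have hUf := hbound f hf hf1 hfM
  have hUft : Ups (transCost k) f ≠ ∞ := ne_top_of_le_ne_top (by finiteness) hUf
  obtain ⟨γ, hγ, hγc⟩ : ∃ γ ∈ ExtPlans f,
      planCost (transCost k) γ < Ups (transCost k) f + e := by
    have h := ENNReal.lt_add_right hUft he0
    conv_lhs at h => rw [Ups]
    simpa only [iInf_lt_iff, exists_prop] using h
  have hγL : planCost (transCost k) γ ≤ L := hγc.le.trans (add_le_add hUf he1)
  have htl := lintegral_tail_le hk hγ hR0 htail
    (fun z hz => ENNReal.ofReal_le_ofReal (hR z hz)) (by simpa using hΛ0)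
    ENNReal.ofReal_ne_top hγL hLe (φ := fun x => 1 - ∑ i, ENNReal.ofReal (χ i x))
    (fun x => tsub_le_self) (fun x hx => by simp [hχρ x hx])
  refine (Ups_le_planCost_add hc hq hM hvol hfin hCq hf hf1.2 hg hg1.2 hfM hgM hγ
    (fun i => (χ i).continuous.measurable.ennreal_ofReal) hχ1 hχfin hκ).trans ?_
  rw [← testGap]
  calc _ ≤ (Ups (transCost k) f + e) + e * M + ENNReal.ofReal C *
        (testGap (fun i x => ENNReal.ofReal (χ i x)) f g + 3 * e) := by gcongr
    _ = _ := by ring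

theorem lintegral_ofReal_mul {f : Rd d → ℝ} (hf : InUnit f)
    (ξ : BoundedContinuousFunction (Rd d) ℝ) (hξ : ∀ x, 0 ≤ ξ x) :
    ∫⁻ x, ENNReal.ofReal (ξ x) * ENNReal.ofReal (f x) = ENNReal.ofReal (∫ x, f x * ξ x) := by
  rw [ofReal_integral_eq_lintegral_ofReal]
  · refine lintegral_congr fun x => ?_
    rw [← ENNReal.ofReal_mul (hξ x), mul_comm]
  · refine hf.1.mul_bdd (c := ‖ξ‖) ξ.continuous.aestronglyMeasurable
      (ae_of_all _ fun x => ξ.norm_coe_le_norm x)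
  · exact ae_of_all _ fun x => mul_nonneg (hf.2 x).1 (hξ x)

theorem tendsto_lintegral_ofReal_mul {f : Rd d → ℝ} {fn : ℕ → Rd d → ℝ} (hf : InUnit f)
    (hfn : ∀ n, InUnit (fn n))
    (hconv : ∀ ξ : BoundedContinuousFunction (Rd d) ℝ,
      Tendsto (fun n => ∫ x, fn n x * ξ x) atTop (nhds (∫ x, f x * ξ x)))
    (ξ : BoundedContinuousFunction (Rd d) ℝ) (hξ : ∀ x, 0 ≤ ξ x) :
    Tendsto (fun n => ∫⁻ x, ENNReal.ofReal (ξ x) * ENNReal.ofReal (fn n x)) atTop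
      (nhds (∫⁻ x, ENNReal.ofReal (ξ x) * ENNReal.ofReal (f x))) := by
  simp only [lintegral_ofReal_mul hf ξ hξ, lintegral_ofReal_mul (hfn _) ξ hξ]
  exact ENNReal.tendsto_ofReal (hconv ξ)

theorem tendsto_lintegral_ofReal {f : Rd d → ℝ} {fn : ℕ → Rd d → ℝ} (hf : InUnit f)
    (hfn : ∀ n, InUnit (fn n))
    (hconv : ∀ ξ : BoundedContinuousFunction (Rd d) ℝ,
      Tendsto (fun n => ∫ x, fn n x * ξ x) atTop (nhds (∫ x, f x * ξ x))) :
    Tendsto (fun n => ∫⁻ x, ENNReal.ofReal (fn n x)) atTop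
      (nhds (∫⁻ x, ENNReal.ofReal (f x))) := by
  simpa using tendsto_lintegral_ofReal_mul hf hfn hconv
    (BoundedContinuousFunction.const (Rd d) 1) (by simp)

theorem InUnit.lintegral_ne_top {f : Rd d → ℝ} (hf : InUnit f) :
    ∫⁻ x, ENNReal.ofReal (f x) ≠ ∞ := by
  rw [← ofReal_integral_eq_lintegral_ofReal hf.1 (ae_of_all _ fun x => (hf.2 x).1)]
  exact ENNReal.ofReal_ne_top

theorem tendsto_testGap {f : Rd d → ℝ} {fn : ℕ → Rd d → ℝ} (hf : InUnit f)
    (hfn : ∀ n, InUnit (fn n))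
    (hconv : ∀ ξ : BoundedContinuousFunction (Rd d) ℝ,
      Tendsto (fun n => ∫ x, fn n x * ξ x) atTop (nhds (∫ x, f x * ξ x)))
    {ι : Type*} [Fintype ι] (χ : ι → BoundedContinuousFunction (Rd d) ℝ)
    (hχ : ∀ i x, 0 ≤ χ i x) :
    Tendsto (fun n => testGap (fun i x => ENNReal.ofReal (χ i x)) (fn n) f) atTop (nhds 0) ∧
      Tendsto (fun n => testGap (fun i x => ENNReal.ofReal (χ i x)) f (fn n)) atTop (nhds 0) := by
  have hm := tendsto_lintegral_ofReal hf hfn hconv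
  have hi := fun i => tendsto_lintegral_ofReal_mul hf hfn hconv (χ i) (hχ i)
  have hsub : ∀ {u : ℕ → ℝ≥0∞} {a : ℝ≥0∞}, a ≠ ∞ → Tendsto u atTop (nhds a) →
      Tendsto (fun n => u n - a) atTop (nhds 0) ∧ Tendsto (fun n => a - u n) atTop (nhds 0) := by
    intro u a ha hu
    rw [← tsub_self a]
    exact ⟨ENNReal.Tendsto.sub hu tendsto_const_nhds (Or.inl ha),
      ENNReal.Tendsto.sub tendsto_const_nhds hu (Or.inl ha)⟩
  have hmt := hsub hf.lintegral_ne_top hm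
  have hit := fun i => hsub (by
    rw [lintegral_ofReal_mul hf (χ i) (hχ i)]
    exact ENNReal.ofReal_ne_top) (hi i)
  have hs1 := tendsto_finsetSum Finset.univ fun i _ => (hit i).1
  have hs2 := tendsto_finsetSum Finset.univ fun i _ => (hit i).2
  unfold testGap
  constructor
  · simpa using hmt.2.add (hs1.add hs2)
  · simpa using hmt.1.add (hs2.add hs1)

theorem fMeas_compl_le {f : Rd d → ℝ} (hf : InUnit f) {s : Set (Rd d)} (hs : MeasurableSet s)
    {e : ℝ≥0∞} (h : ∫ x in sᶜ, f x ≤ e.toReal) : fMeas f sᶜ ≤ e := by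
  rw [fMeas, withDensity_apply _ hs.compl, ← ofReal_integral_eq_lintegral_ofReal
    hf.1.integrableOn (ae_of_all _ fun x => (hf.2 x).1)]
  exact ENNReal.ofReal_le_of_le_toReal h

theorem exists_tail_radius {f : Rd d → ℝ} {fn : ℕ → Rd d → ℝ} (hf : InUnit f)
    (hfn : ∀ n, InUnit (fn n))
    (htight : ∀ ε : ℝ, 0 < ε → ∃ K : Set (Rd d), IsCompact K ∧
      ∀ n, (∫ x in Kᶜ, fn n x) ≤ ε) {e : ℝ≥0∞} (he0 : e ≠ 0) (he : e ≠ ∞) :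
    ∃ r : ℝ, fMeas f (Metric.closedBall 0 r)ᶜ ≤ e ∧
      ∀ n, fMeas (fn n) (Metric.closedBall 0 r)ᶜ ≤ e := by
  obtain ⟨K, hK, hKn⟩ := htight e.toReal (ENNReal.toReal_pos he0 he)
  have hfin : IsFiniteMeasure (fMeas f) := isFiniteMeasure_withDensity hf.lintegral_ne_top
  obtain ⟨K', -, hK', hKf⟩ := MeasurableSet.univ.exists_isCompact_sdiff_lt
    (measure_ne_top (fMeas f) _) he0
  obtain ⟨r, hr⟩ := (hK.union hK').isBounded.subset_closedBall 0
  refine ⟨r, ?_, fun n => ?_⟩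
  · refine (measure_mono fun x hx => ?_).trans hKf.le
    exact ⟨mem_univ _, fun h => hx (hr (Or.inr h))⟩
  · refine (measure_mono fun x hx => ?_).trans
      (fMeas_compl_le (hfn n) hK.measurableSet (hKn n))
    exact fun h => hx (hr (Or.inl h))

theorem tendsto_Ups_of_measurable (hd : 1 ≤ d) {k : Rd d → ℝ} (h1 : H1 k)
    {f : Rd d → ℝ} {fn : ℕ → Rd d → ℝ} (hfm : Measurable f) (hfnm : ∀ n, Measurable (fn n))
    (hf : InUnit f) (hfn : ∀ n, InUnit (fn n))
    (htight : ∀ ε : ℝ, 0 < ε → ∃ K : Set (Rd d), IsCompact K ∧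
      ∀ n, (∫ x in Kᶜ, fn n x) ≤ ε)
    (hconv : ∀ ξ : BoundedContinuousFunction (Rd d) ℝ,
      Tendsto (fun n => ∫ x, fn n x * ξ x) atTop (nhds (∫ x, f x * ξ x))) :
    Tendsto (fun n => Ups (transCost k) (fn n)) atTop (nhds (Ups (transCost k) f)) := by
  set M : ℝ≥0∞ := (∫⁻ x, ENNReal.ofReal (f x)) + 1 with hMdef
  have hM : M ≠ ∞ := ENNReal.add_ne_top.2 ⟨hf.lintegral_ne_top, one_ne_top⟩
  have hfM : ∫⁻ x, ENNReal.ofReal (f x) ≤ M := le_self_add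
  have hfnM : ∀ᶠ n in atTop, ∫⁻ x, ENNReal.ofReal (fn n x) ≤ M :=
    ((tendsto_lintegral_ofReal hf hfn hconv).eventually_lt_const
      (ENNReal.lt_add_right hf.lintegral_ne_top one_ne_zero)).mono fun n hn => hn.le
  obtain ⟨C, hCt, hbound, hmod⟩ := exists_Ups_modulus hd h1 hM
  have hUt : Ups (transCost k) f ≠ ∞ :=
    ne_top_of_le_ne_top (ENNReal.mul_ne_top hCt hM) (hbound f hfm hf hfM)
  rw [ENNReal.tendsto_nhds hUt]
  intro ε hε
  have hDt : 1 + M + C * 3 ≠ ∞ := by finiteness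
  set e : ℝ≥0∞ := min 1 (ε / 2 / (1 + M + C * 3)) with he
  have he0 : e ≠ 0 := by
    have : ε / 2 / (1 + M + C * 3) ≠ 0 :=
      ENNReal.div_ne_zero.2 ⟨ENNReal.div_ne_zero.2 ⟨hε.ne', by simp⟩, hDt⟩
    exact (lt_min one_pos (pos_iff_ne_zero.2 this)).ne'
  have he1 : e ≤ 1 := min_le_left _ _
  have heε : e * (1 + M + C * 3) ≤ ε / 2 :=
    (mul_le_mul_left (min_le_right _ _) _).trans (ENNReal.div_mul_cancel (by positivity) hDt).le
  obtain ⟨r, hr, hrn⟩ := exists_tail_radius hf hfn htight he0 (ne_top_of_le_ne_top one_ne_top he1)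
  obtain ⟨ι, _, χ, hχ, hχU⟩ := hmod e he0 he1 r
  obtain ⟨hg1, hg2⟩ := tendsto_testGap hf hfn hconv χ hχ
  have hsmall : ∀ {u : ℕ → ℝ≥0∞}, Tendsto u atTop (nhds 0) → ∀ᶠ n in atTop, C * u n ≤ ε / 2 := by
    intro u hu
    have h := ENNReal.Tendsto.const_mul hu (Or.inr hCt)
    rw [mul_zero] at h
    exact (h.eventually_lt_const (ENNReal.half_pos hε.ne')).mono fun n hn => hn.le
  filter_upwards [hfnM, hsmall hg1, hsmall hg2] with n hn h3 h4
  refine ⟨?_, ?_⟩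
  · rw [tsub_le_iff_right]
    refine (hχU (fn n) f (hfnm n) hfm (hfn n) hf hn hfM (hrn n)).trans ?_
    rw [add_assoc]
    gcongr
    exact (add_le_add heε h3).trans_eq (ENNReal.add_halves ε)
  · refine (hχU f (fn n) hfm (hfnm n) hf (hfn n) hfM hn hr).trans ?_
    rw [add_assoc]
    gcongr
    exact (add_le_add heε h4).trans_eq (ENNReal.add_halves ε)

end

/-- under (H1), if `fₙ ∈ L¹(ℝ^d,[0,1])` is tight and `fₙ·Leb → f·Leb` in duality
with bounded continuous functions, then `Υ(fₙ) → Υ(f)`. -/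
theorem stmt_12 {d : ℕ} (hd : 1 ≤ d) (k : Rd d → ℝ) (hpos : ∀ x, 0 ≤ k x) (h1 : H1 k)
    (f : Rd d → ℝ) (fn : ℕ → Rd d → ℝ) (hf : InUnit f) (hfn : ∀ n, InUnit (fn n))
    (htight : ∀ ε : ℝ, 0 < ε → ∃ K : Set (Rd d), IsCompact K ∧
      ∀ n, (∫ x in Kᶜ, fn n x) ≤ ε)
    (hconv : ∀ ξ : BoundedContinuousFunction (Rd d) ℝ,
      Tendsto (fun n => ∫ x, fn n x * ξ x) atTop (nhds (∫ x, f x * ξ x))) :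
    Tendsto (fun n => Ups (transCost k) (fn n)) atTop (nhds (Ups (transCost k) f)) := by
  obtain ⟨g, hgm, hg, hfg⟩ := hf.exists_measurable
  choose gn hgnm hgn hfgn using fun n => (hfn n).exists_measurable
  rw [Ups_congr hfg]
  simp only [fun n => Ups_congr (c := transCost k) (hfgn n)]
  refine tendsto_Ups_of_measurable hd h1 hgm hgnm hg hgn (fun ε hε => ?_) fun ξ => ?_
  · obtain ⟨K, hK, hKn⟩ := htight ε hε
    exact ⟨K, hK, fun n =>
      (integral_congr_ae (ae_restrict_of_ae (hfgn n))).symm.trans_le (hKn n)⟩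
  · have h : ∀ {u v : Rd d → ℝ}, u =ᵐ[volume] v → ∫ x, u x * ξ x = ∫ x, v x * ξ x :=
      fun huv => integral_congr_ae (huv.mono fun x hx => by simp only [hx])
    rw [← h hfg]
    simpa only [← h (hfgn _)] using hconv ξ
end
end

section
/- Assume c(x,y) = k(y−x) with k satisfying (H1) and (H2). Let m > 0, f ∈ L^1_m, and let γ be a minimiser of Υ(f). Then for every (x_0, y_0) ∈ supp γ, one has f + γ_y ≡ 1 Lebesgue-almost everywhere on the saturation set S(x_0,y_0) := {y ∈ ℝ^d : k(y − x_0) < k(y_0 − x_0)}. -/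
open MeasureTheory ENNReal Filter Set

noncomputable section

/-- A plan that spreads the mass of `μ` in each cell of a countable partition over the mass of
`ρ` in the same cell. -/
theorem exists_plan_of_cells {α ι : Type*} [MeasurableSpace α] [Countable ι] [MeasurableSpace ι]
    [MeasurableSingletonClass ι] (μ ρ : Measure α) [SFinite μ] [SFinite ρ] (q : α → ι)
    (hq : Measurable q) (hle : ∀ z, μ (q ⁻¹' {z}) ≤ ρ (q ⁻¹' {z}))
    (hpos : ∀ z, ρ (q ⁻¹' {z}) ≠ 0) (hfin : ∀ z, ρ (q ⁻¹' {z}) ≠ ∞) :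
    ∃ γ : Measure (α × α), γ.map Prod.fst = μ ∧ γ.map Prod.snd ≤ ρ ∧
      ∀ᵐ p ∂γ, q p.1 = q p.2 := by
  have hQ : ∀ z, MeasurableSet (q ⁻¹' {z}) := fun z => hq (measurableSet_singleton z)
  have hsum : ∀ κ : Measure α, Measure.sum (fun z => κ.restrict (q ⁻¹' {z})) = κ := by
    intro κ
    rw [← Measure.restrict_iUnion (fun i j hij => ?_) hQ]
    · have : (⋃ z, q ⁻¹' {z}) = univ := by ext x; simp
      rw [this, Measure.restrict_univ]
    · exact Disjoint.preimage _ (by simpa using hij)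
  refine ⟨Measure.sum fun z =>
    (ρ (q ⁻¹' {z}))⁻¹ • (μ.restrict (q ⁻¹' {z})).prod (ρ.restrict (q ⁻¹' {z})), ?_, ?_, ?_⟩
  · rw [Measure.map_sum measurable_fst.aemeasurable]
    conv_rhs => rw [← hsum μ]
    congr 1
    ext1 z
    rw [Measure.map_smul, Measure.map_fst_prod, smul_smul, Measure.restrict_apply_univ,
      ENNReal.inv_mul_cancel (hpos z) (hfin z), one_smul]
  · rw [Measure.map_sum measurable_snd.aemeasurable]
    conv_rhs => rw [← hsum ρ]
    refine Measure.le_intro fun s hs _ => ?_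
    rw [Measure.sum_apply _ hs, Measure.sum_apply _ hs]
    refine ENNReal.tsum_le_tsum fun z => ?_
    rw [Measure.map_smul, Measure.map_snd_prod, smul_smul, Measure.restrict_apply_univ]
    rw [Measure.smul_apply, smul_eq_mul]
    refine mul_le_of_le_one_left zero_le ?_
    rw [mul_comm, ← div_eq_mul_inv]
    exact ENNReal.div_le_of_le_mul (by simpa using hle z)
  · rw [Measure.ae_sum_iff]
    intro z
    refine Measure.ae_smul_measure ?_ _
    rw [Measure.prod_restrict]
    filter_upwards [ae_restrict_mem ((hQ z).prod (hQ z))] with p hp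
    exact (hp.1 : q p.1 = z).trans (hp.2 : q p.2 = z).symm

/-- The cell of the cubic grid of side `L` containing a point. -/
def gridCell {d : ℕ} (L : ℝ) (x : Rd d) : Fin d → ℤ := fun i => ⌊x i / L⌋

theorem measurable_gridCell {d : ℕ} (L : ℝ) : Measurable (gridCell (d := d) L) := by
  refine measurable_pi_lambda _ fun i => ?_
  unfold gridCell
  exact Int.measurable_floor.comp (by fun_prop)

theorem volume_gridCell {d : ℕ} {L : ℝ} (hL : 0 < L) (z : Fin d → ℤ) :
    volume (gridCell L ⁻¹' {z} : Set (Rd d)) = ENNReal.ofReal L ^ d := by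
  have h : (gridCell L ⁻¹' {z} : Set (Rd d)) =
      (MeasurableEquiv.toLp 2 (Fin d → ℝ)).symm ⁻¹'
        (Set.pi univ fun i => Ico (z i * L) ((z i + 1) * L)) := by
    ext x
    simp only [mem_preimage, mem_singleton_iff, gridCell, funext_iff, Int.floor_eq_iff,
      Set.mem_pi, mem_univ, true_imp_iff, mem_Ico, le_div_iff₀ hL, div_lt_iff₀ hL]
    rfl
  rw [h, (EuclideanSpace.volume_preserving_symm_measurableEquiv_toLp (Fin d)).measure_preimage_equiv,
    volume_pi_pi]
  simp [Real.volume_Ico, ← sub_mul]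

theorem abs_sub_le_of_gridCell_eq {d : ℕ} {L : ℝ} (hL : 0 < L) {x y : Rd d}
    (h : gridCell L x = gridCell L y) (i : Fin d) : |y i - x i| ≤ L := by
  have h1 := Int.abs_sub_lt_one_of_floor_eq_floor (congrFun h i).symm
  rw [← sub_div, abs_div, abs_of_pos hL, div_lt_one hL] at h1
  exact h1.le

theorem exists_bound_of_coord_le {d : ℕ} {k : Rd d → ℝ} (hk : Continuous k) (L : ℝ) :
    ∃ M, ∀ v : Rd d, (∀ i, |v i| ≤ L) → k v ≤ M := by
  have hc : IsCompact (Set.pi univ fun _ : Fin d => Icc (-L) L) :=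
    isCompact_univ_pi fun _ => isCompact_Icc
  obtain ⟨M, hM⟩ := hc.bddAbove_image
    (f := fun v => k (WithLp.toLp 2 v)) (hk.comp (PiLp.continuous_toLp 2 _)).continuousOn
  exact ⟨M, fun v hv => hM ⟨WithLp.ofLp v, fun i _ => abs_le.1 (hv i), rfl⟩⟩

theorem fMeas_add_fMeas_one_sub {d : ℕ} {f : Rd d → ℝ} (hf : InUnit f) :
    fMeas f + fMeas (fun x => 1 - f x) = volume := by
  refine Measure.ext fun s hs => ?_
  simp only [fMeas, Measure.add_apply, withDensity_apply _ hs]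
  rw [← lintegral_add_left' hf.1.aemeasurable.ennreal_ofReal.restrict, ← setLIntegral_one]
  refine lintegral_congr fun x => ?_
  rw [← ENNReal.ofReal_add (hf.2 x).1 (by linarith [(hf.2 x).2])]
  simp

theorem fMeas_univ {d : ℕ} {f : Rd d → ℝ} (hf : InUnit f) :
    fMeas f univ = ENNReal.ofReal (∫ x, f x) := by
  rw [fMeas, withDensity_apply _ MeasurableSet.univ, Measure.restrict_univ,
    ofReal_integral_eq_lintegral_ofReal hf.1 (ae_of_all _ fun x => (hf.2 x).1)]

theorem Ups_transCost_lt_top {d : ℕ} (hd : 1 ≤ d) {k : Rd d → ℝ} (hk : Continuous k)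
    {f : Rd d → ℝ} (hf : InUnit f) : Ups (transCost k) f < ∞ := by
  obtain ⟨L, hL1, hL⟩ : ∃ L : ℝ, 1 ≤ L ∧ 2 * (∫ x, f x) + 1 ≤ L :=
    ⟨max 1 (2 * (∫ x, f x) + 1), le_max_left _ _, le_max_right _ _⟩
  have hL0 : 0 < L := by linarith
  have hI : 0 ≤ ∫ x, f x := integral_nonneg fun x => (hf.2 x).1
  set q : Rd d → Fin d → ℤ := gridCell L
  have hvol : ∀ z, fMeas f (q ⁻¹' {z}) + fMeas (fun x => 1 - f x) (q ⁻¹' {z}) =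
      ENNReal.ofReal (L ^ d) := fun z => by
    rw [← Measure.add_apply, fMeas_add_fMeas_one_sub hf, volume_gridCell hL0,
      ENNReal.ofReal_pow hL0.le]
  have hLd : 2 * (∫ x, f x) + 1 ≤ L ^ d := hL.trans (le_self_pow₀ hL1 (by omega))
  have hsmall : ∀ z, fMeas f (q ⁻¹' {z}) ≤ ENNReal.ofReal (∫ x, f x) := fun z =>
    (measure_mono (subset_univ _)).trans (fMeas_univ hf).le
  have hbig : ∀ z, ENNReal.ofReal ((∫ x, f x) + 1) ≤ fMeas (fun x => 1 - f x) (q ⁻¹' {z}) := by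
    intro z
    have h1 : ENNReal.ofReal (∫ x, f x) + ENNReal.ofReal ((∫ x, f x) + 1) ≤
        ENNReal.ofReal (∫ x, f x) + fMeas (fun x => 1 - f x) (q ⁻¹' {z}) := by
      rw [← ENNReal.ofReal_add hI (by linarith)]
      calc _ ≤ ENNReal.ofReal (L ^ d) := ENNReal.ofReal_le_ofReal (by linarith)
        _ = _ := (hvol z).symm
        _ ≤ _ := by gcongr; exact hsmall z
    exact (ENNReal.add_le_add_iff_left ENNReal.ofReal_ne_top).1 h1
  have : SFinite (fMeas f) := by unfold fMeas; infer_instance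
  have : SFinite (fMeas fun x => 1 - f x) := by unfold fMeas; infer_instance
  obtain ⟨γ, hγ1, hγ2, hγq⟩ := exists_plan_of_cells (fMeas f) (fMeas fun x => 1 - f x) q
    (measurable_gridCell L)
    (fun z => (hsmall z).trans ((ENNReal.ofReal_le_ofReal (by linarith)).trans (hbig z)))
    (fun z => ((ENNReal.ofReal_pos.2 (by linarith)).trans_le (hbig z)).ne')
    (fun z => ((le_add_self.trans (hvol z).le).trans_lt ENNReal.ofReal_lt_top).ne)
  obtain ⟨M, hM⟩ := exists_bound_of_coord_le hk L
  calc Ups (transCost k) f ≤ planCost (transCost k) γ := iInf₂_le γ ⟨hγ1, hγ2⟩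
    _ ≤ ∫⁻ _, ENNReal.ofReal M ∂γ := by
      refine lintegral_mono_ae ?_
      filter_upwards [hγq] with p hp
      exact ENNReal.ofReal_le_ofReal (hM _ fun i => abs_sub_le_of_gridCell_eq hL0 hp i)
    _ < ∞ := by
      rw [lintegral_const, ← preimage_univ (f := Prod.fst),
        ← Measure.map_apply measurable_fst MeasurableSet.univ, hγ1, fMeas_univ hf]
      exact ENNReal.mul_lt_top ENNReal.ofReal_lt_top ENNReal.ofReal_lt_top

/-- Part of the mass of `γ` in `U` can be sent, with the same first marginal, to a measure `τ`
which is added to the second marginal; optimality of `γ` prevents this from lowering the cost. -/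
theorem planCost_reroute {d : ℕ} {c : Rd d → Rd d → ℝ}
    {f : Rd d → ℝ} {γ : Measure (Rd d × Rd d)} [IsFiniteMeasure γ] (hγ : γ ∈ ExtPlans f)
    {τ : Measure (Rd d)} [IsFiniteMeasure τ]
    (hτ : γ.map Prod.snd + τ ≤ fMeas fun x => 1 - f x) (hτ0 : τ ≠ 0)
    {U : Set (Rd d × Rd d)} (hU : MeasurableSet U) :
    Ups c f ≤ planCost c (γ.restrict Uᶜ) +
      γ U / (τ univ + γ U) * planCost c (γ.restrict U) +
      (τ univ + γ U)⁻¹ * planCost c (((γ.restrict U).map Prod.fst).prod τ) := by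
  set T := τ univ
  set G := γ U
  have hT0 : T ≠ 0 := by simpa [T] using hτ0
  have hTG0 : T + G ≠ 0 := by simp [hT0]
  have hTG : T + G ≠ ∞ := by finiteness
  set γ' : Measure (Rd d × Rd d) := γ.restrict Uᶜ + (G / (T + G)) • γ.restrict U +
    (T + G)⁻¹ • ((γ.restrict U).map Prod.fst).prod τ with hγ'
  have hsplit : γ.restrict Uᶜ + γ.restrict U = γ := by
    rw [add_comm, Measure.restrict_add_restrict_compl hU]
  have hmem : γ' ∈ ExtPlans f := by
    constructor
    · rw [← hγ.1, hγ', Measure.map_add _ _ measurable_fst, Measure.map_add _ _ measurable_fst,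
        Measure.map_smul, Measure.map_smul, Measure.map_fst_prod, smul_smul, add_assoc,
        ← add_smul]
      have : G / (T + G) + (T + G)⁻¹ * τ univ = 1 := by
        rw [div_eq_mul_inv, mul_comm, ← mul_add, add_comm G, ENNReal.inv_mul_cancel hTG0 hTG]
      rw [this, one_smul, ← Measure.map_add _ _ measurable_fst, hsplit]
    · refine le_trans ?_ hτ
      conv_rhs => rw [← hsplit]
      rw [hγ', Measure.map_add _ _ measurable_snd, Measure.map_add _ _ measurable_snd,
        Measure.map_add _ _ measurable_snd,
        Measure.map_smul, Measure.map_smul, Measure.map_snd_prod, smul_smul,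
        Measure.map_apply measurable_fst MeasurableSet.univ, preimage_univ,
        Measure.restrict_apply_univ]
      have hG : G / (T + G) ≤ 1 := ENNReal.div_le_of_le_mul (by simp)
      have hG' : (T + G)⁻¹ * γ U ≤ 1 := by rwa [mul_comm, ← div_eq_mul_inv]
      refine Measure.le_intro fun s _ _ => ?_
      simp only [Measure.add_apply, Measure.smul_apply, smul_eq_mul]
      gcongr
      · exact mul_le_of_le_one_left zero_le hG
      · exact mul_le_of_le_one_left zero_le hG'
  refine (iInf₂_le γ' hmem).trans_eq ?_
  simp only [planCost, hγ', lintegral_add_measure, lintegral_smul_measure, smul_eq_mul]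

/-- under (H1),(H2), if `γ` minimises `Υ(f)` then for every
`(x₀,y₀) ∈ supp γ` one has `f + γ_y ≡ 1` a.e. on the saturation set
`S(x₀,y₀) = {y : k(y-x₀) < k(y₀-x₀)}` (stated as equality of the restricted measures
`γ_y|_S = ((1-f)·Leb)|_S`). -/
theorem stmt_13 {d : ℕ} (hd : 1 ≤ d) (k : Rd d → ℝ) (hpos : ∀ x, 0 ≤ k x)
    (h1 : H1 k) (h2 : H2 k) (m : ℝ) (hm : 0 < m) (f : Rd d → ℝ) (hf : MemL1m m f)
    (γ : Measure (Rd d × Rd d)) (hγ : γ ∈ ExtPlans f)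
    (hopt : planCost (transCost k) γ = Ups (transCost k) f) :
    ∀ x₀ y₀ : Rd d, (x₀, y₀) ∈ msupport γ →
      (γ.map Prod.snd).restrict {y | k (y - x₀) < k (y₀ - x₀)} =
        (fMeas fun x => 1 - f x).restrict {y | k (y - x₀) < k (y₀ - x₀)} := by
  intro x₀ y₀ hsupp
  have hk := h1.1
  have hfin := Ups_transCost_lt_top hd hk hf.1
  have hγfin : IsFiniteMeasure γ := by
    constructor
    rw [← preimage_univ (f := Prod.fst), ← Measure.map_apply measurable_fst MeasurableSet.univ,
      hγ.1, fMeas_univ hf.1]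
    exact ENNReal.ofReal_lt_top
  have hνfin : IsFiniteMeasure (γ.map Prod.snd) := inferInstance
  set S := {y | k (y - x₀) < k (y₀ - x₀)}
  set ρ := fMeas fun x => 1 - f x
  set σ := ρ - γ.map Prod.snd
  have hσ : γ.map Prod.snd + σ = ρ := by
    rw [add_comm]; exact Measure.sub_add_cancel_of_le hγ.2
  by_cases hσS : σ S = 0
  · rw [← hσ, Measure.restrict_add, Measure.restrict_eq_zero.2 hσS, add_zero]
  exfalso
  obtain ⟨y₁, hy₁, hy₁σ⟩ := exists_mem_forall_mem_nhdsWithin_pos_measure hσS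
  obtain ⟨a, ha, hay⟩ := exists_between (show k (y₁ - x₀) < k (y₀ - x₀) from hy₁)
  obtain ⟨b, hab, hby⟩ := exists_between hay
  have ha0 : 0 ≤ a := (hpos _).trans ha.le
  have hnear : ∀ᶠ p : Rd d × Rd d in nhds (x₀, y₁), k (p.2 - p.1) < a :=
    (hk.comp (continuous_snd.sub continuous_fst)).continuousAt.eventually_lt_const ha
  rw [nhds_prod_eq] at hnear
  obtain ⟨P₁, hP₁, P₂, hP₂, hP⟩ := eventually_prod_iff.1 hnear
  obtain ⟨U₁, hU₁P, hU₁, hxU₁⟩ := mem_nhds_iff.1 hP₁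
  obtain ⟨U₂, hU₂P, hU₂, hyU₂⟩ := mem_nhds_iff.1 hP₂
  set V : Set (Rd d) := U₂ ∩ Metric.ball y₁ 1
  have hVo : IsOpen V := hU₂.inter Metric.isOpen_ball
  have hV : V ∈ nhds y₁ := hVo.mem_nhds ⟨hyU₂, Metric.mem_ball_self one_pos⟩
  have hσvol : σ ≤ volume := by
    rw [← fMeas_add_fMeas_one_sub hf.1]
    exact Measure.sub_le.trans (Measure.le_add_left le_rfl)
  have hτfin : IsFiniteMeasure (σ.restrict V) := by
    refine isFiniteMeasure_restrict.2 (ne_of_lt ?_)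
    exact ((hσvol V).trans (measure_mono inter_subset_right)).trans_lt measure_ball_lt_top
  have hτ0 : σ.restrict V ≠ 0 := fun h =>
    (hy₁σ V (mem_nhdsWithin_of_mem_nhds hV)).ne' (Measure.restrict_eq_zero.1 h)
  set U : Set (Rd d × Rd d) := Prod.fst ⁻¹' U₁ ∩ {p | b < k (p.2 - p.1)}
  have hUo : IsOpen U := (hU₁.preimage continuous_fst).inter
    (isOpen_lt continuous_const (hk.comp (continuous_snd.sub continuous_fst)))
  have hG0 : γ U ≠ 0 := (hsupp U hUo ⟨hxU₁, hby⟩).ne'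
  have hre := planCost_reroute (c := transCost k) hγ (τ := σ.restrict V)
    ((add_le_add_right Measure.restrict_le_self _).trans hσ.le) hτ0 hUo.measurableSet
  set T := σ.restrict V univ
  set G := γ U
  have hT0 : T ≠ 0 := by simpa [T] using hτ0
  have hTG0 : T + G ≠ 0 := by simp [hT0]
  have hT : T ≠ ∞ := by finiteness
  have hG : G ≠ ∞ := by finiteness
  have hsplit : planCost (transCost k) γ = planCost (transCost k) (γ.restrict Uᶜ) +
      planCost (transCost k) (γ.restrict U) := by
    rw [add_comm]
    exact (lintegral_add_compl _ hUo.measurableSet).symm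
  have hlow : ENNReal.ofReal b * G ≤ planCost (transCost k) (γ.restrict U) := by
    rw [← setLIntegral_const]
    exact setLIntegral_mono' hUo.measurableSet fun p hp =>
      ENNReal.ofReal_le_ofReal (le_of_lt hp.2)
  have hup : planCost (transCost k) (((γ.restrict U).map Prod.fst).prod (σ.restrict V)) ≤
      ENNReal.ofReal a * (G * T) := by
    have hmass : ((γ.restrict U).map Prod.fst).prod (σ.restrict V) univ = G * T := by
      rw [← univ_prod_univ, Measure.prod_prod,
        Measure.map_apply measurable_fst MeasurableSet.univ, preimage_univ,
        Measure.restrict_apply_univ]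
    rw [← hmass, ← lintegral_const]
    refine lintegral_mono_ae ?_
    have hfst : ∀ᵐ x ∂((γ.restrict U).map Prod.fst), x ∈ U₁ :=
      (ae_map_iff measurable_fst.aemeasurable hU₁.measurableSet).2
        ((ae_restrict_mem hUo.measurableSet).mono fun p hp => hp.1)
    filter_upwards [Measure.quasiMeasurePreserving_fst.ae hfst,
      Measure.quasiMeasurePreserving_snd.ae (ae_restrict_mem hVo.measurableSet)] with p hp₁ hp₂
    exact ENNReal.ofReal_le_ofReal (hP (hU₁P hp₁) (hU₂P hp₂.1)).le
  rw [← hopt, hsplit] at hre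
  rw [← hopt, hsplit] at hfin
  set A := planCost (transCost k) (γ.restrict Uᶜ)
  set B := planCost (transCost k) (γ.restrict U)
  have hA : A ≠ ∞ := (le_self_add.trans_lt hfin).ne
  have hB : B ≠ ∞ := (le_add_self.trans_lt hfin).ne
  have hfin' : G / (T + G) * B ≠ ∞ := by finiteness
  have hBs : B = G / (T + G) * B + (T + G)⁻¹ * (T * B) := by
    rw [div_eq_mul_inv, mul_comm G, mul_assoc, ← mul_add, ← add_mul, add_comm G, ← mul_assoc,
      ENNReal.inv_mul_cancel hTG0 (by finiteness), one_mul]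
  rw [add_assoc, ENNReal.add_le_add_iff_left hA] at hre
  conv_lhs at hre => rw [hBs]
  rw [ENNReal.add_le_add_iff_left hfin',
    ENNReal.mul_le_mul_iff_right (ENNReal.inv_ne_zero.2 (by finiteness)) (by simp [hT0])] at hre
  have hlt : ENNReal.ofReal a * (G * T) < ENNReal.ofReal b * (G * T) :=
    (ENNReal.mul_lt_mul_iff_left (mul_ne_zero hG0 hT0) (by finiteness)).2
      ((ENNReal.ofReal_lt_ofReal_iff_of_nonneg ha0).2 hab)
  refine absurd (hre.trans hup) (not_le.2 (hlt.trans_le ?_))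
  calc ENNReal.ofReal b * (G * T) = T * (ENNReal.ofReal b * G) := by ring
    _ ≤ T * B := by gcongr
end
end

section
/- Assume c(x,y) = k(y−x) with k satisfying (H1) and (H2). Let m > 0 and f_1, f_2 ∈ L^1_m with f_1 ≤ f_2 pointwise, and let γ^1, γ^2 be minimisers of Υ(f_1) and Υ(f_2) respectively. Then, setting g_1 := γ^1_y and g_2 := γ^2_y, one has f_1 + g_1 ≤ f_2 + g_2 Lebesgue-almost everywhere. -/
open MeasureTheory ENNReal Filter Set

noncomputable section

/-- `γ` transports `F` to a measure that fits below Lebesgue measure on top of `F`, with finite and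
minimal cost among all such plans. -/
structure IsOptimalPlan {d : ℕ} (c : Rd d → Rd d → ℝ) (F : Measure (Rd d))
    (γ : Measure (Rd d × Rd d)) : Prop where
  map_fst : γ.map Prod.fst = F
  add_map_snd_le : F + γ.map Prod.snd ≤ volume
  planCost_ne_top : planCost c γ ≠ ∞
  planCost_le : ∀ γ' : Measure (Rd d × Rd d), γ'.map Prod.fst = F →
    F + γ'.map Prod.snd ≤ volume → planCost c γ ≤ planCost c γ'

theorem planCost_add {d : ℕ} (c : Rd d → Rd d → ℝ) (γ γ' : Measure (Rd d × Rd d)) :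
    planCost c (γ + γ') = planCost c γ + planCost c γ' :=
  lintegral_add_measure _ _ _

theorem exists_pos_mul_le_one {a b : ℝ≥0∞} (ha : a ≠ ∞) (hb : b ≠ ∞) :
    ∃ δ : ℝ≥0∞, δ ≠ 0 ∧ δ ≠ ∞ ∧ δ * a ≤ 1 ∧ δ * b ≤ 1 := by
  have h0 : 1 + a + b ≠ 0 := by simp
  have ht : 1 + a + b ≠ ∞ := by simp [ha, hb]
  have key : ∀ x, x ≤ 1 + a + b → (1 + a + b)⁻¹ * x ≤ 1 := fun x hx =>
    (mul_le_mul_right hx _).trans (ENNReal.inv_mul_cancel h0 ht).le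
  exact ⟨(1 + a + b)⁻¹, ENNReal.inv_ne_zero.2 ht, ENNReal.inv_ne_top.2 h0,
    key _ (le_add_right le_add_self), key _ le_add_self⟩

theorem measurable_transCost {d : ℕ} {k : Rd d → ℝ} (hk : Continuous k) :
    Measurable fun p : Rd d × Rd d => transCost k p.1 p.2 :=
  (hk.comp (continuous_snd.sub continuous_fst)).measurable

/-- Mass of an optimal plan cannot be moved into unsaturated space at a lower cost. -/
theorem IsOptimalPlan.ae_prod_le {d : ℕ} {c : Rd d → Rd d → ℝ}
    (hc : Measurable fun p : Rd d × Rd d => c p.1 p.2) (hpos : ∀ x y, 0 ≤ c x y)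
    {F : Measure (Rd d)} {γ : Measure (Rd d × Rd d)} [IsFiniteMeasure γ]
    (h : IsOptimalPlan c F γ) {ν : Measure (Rd d)} [IsFiniteMeasure ν]
    (hν : F + γ.map Prod.snd + ν ≤ volume) :
    ∀ᵐ t ∂γ.prod ν, c t.1.1 t.1.2 ≤ c t.1.1 t.2 := by
  set T : Set ((Rd d × Rd d) × Rd d) := {t | c t.1.1 t.2 < c t.1.1 t.1.2} with hT
  have hmxz : Measurable fun t : (Rd d × Rd d) × Rd d => (t.1.1, t.2) := by fun_prop
  have hc1 : Measurable fun t : (Rd d × Rd d) × Rd d => c t.1.1 t.1.2 := hc.comp measurable_fst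
  have hc2 : Measurable fun t : (Rd d × Rd d) × Rd d => c t.1.1 t.2 := hc.comp hmxz
  have hTm : MeasurableSet T := measurableSet_lt hc2 hc1
  obtain ⟨δ, hδ0, hδt, hδν, hδγ⟩ :=
    exists_pos_mul_le_one (measure_ne_top ν univ) (measure_ne_top γ univ)
  set Γ := δ • (γ.prod ν).restrict T with hΓ
  have hΓle : Γ ≤ δ • γ.prod ν := by
    rw [hΓ]; gcongr; exact Measure.restrict_le_self
  have hΓfst : Γ.map Prod.fst ≤ γ := by
    refine (Measure.map_mono hΓle measurable_fst).trans ?_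
    rw [Measure.map_smul, Measure.map_fst_prod, smul_smul]
    intro s
    simpa using mul_le_mul_left hδν (γ s)
  have hΓsnd : Γ.map Prod.snd ≤ ν := by
    refine (Measure.map_mono hΓle measurable_snd).trans ?_
    rw [Measure.map_smul, Measure.map_snd_prod, smul_smul]
    intro s
    simpa using mul_le_mul_left hδγ (ν s)
  have : IsFiniteMeasure (Γ.map Prod.fst) := isFiniteMeasure_of_le γ hΓfst
  obtain ⟨r, hr⟩ : ∃ r, γ = r + Γ.map Prod.fst :=
    ⟨γ - Γ.map Prod.fst, (Measure.sub_add_cancel_of_le hΓfst).symm⟩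
  have hmin := h.planCost_le (r + Γ.map fun t => (t.1.1, t.2)) ?_ ?_
  · have hfin := h.planCost_ne_top
    rw [hr, planCost_add] at hmin hfin
    rw [planCost_add] at hmin
    have hle := ENNReal.le_of_add_le_add_left (ENNReal.add_ne_top.1 hfin).1 hmin
    have hfin := (ENNReal.add_ne_top.1 hfin).2
    unfold planCost at hle hfin
    rw [lintegral_map hc.ennreal_ofReal measurable_fst] at hle hfin
    rw [lintegral_map hc.ennreal_ofReal hmxz] at hle
    have hlt : ∀ᵐ t ∂Γ, ENNReal.ofReal (c t.1.1 t.2) < ENNReal.ofReal (c t.1.1 t.1.2) := by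
      refine Measure.ae_smul_measure ?_ δ
      filter_upwards [ae_restrict_mem hTm] with t ht
      exact (ENNReal.ofReal_lt_ofReal_iff ((hpos _ _).trans_lt ht)).2 ht
    have hΓ0 : Γ = 0 := by
      by_contra hne
      refine (lintegral_strict_mono hne hc1.ennreal_ofReal.aemeasurable ?_ hlt).not_ge hle
      exact ne_top_of_le_ne_top hfin (lintegral_mono_ae (hlt.mono fun _ => le_of_lt))
    have : (γ.prod ν) T = 0 := by
      have := congrArg (fun μ : Measure _ => μ univ) hΓ0
      simpa [hΓ, hδ0] using this
    filter_upwards [measure_eq_zero_iff_ae_notMem.1 this] with t ht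
    exact not_lt.1 ht
  · rw [← h.map_fst, Measure.map_add _ _ measurable_fst, Measure.map_map measurable_fst hmxz]
    conv_rhs => rw [hr, Measure.map_add _ _ measurable_fst,
      Measure.map_map measurable_fst measurable_fst]
    rfl
  · refine le_trans ?_ hν
    rw [Measure.map_add _ _ measurable_snd, Measure.map_map measurable_snd hmxz, add_assoc]
    refine add_le_add_right (add_le_add ?_ hΓsnd) F
    refine Measure.map_mono ?_ measurable_snd
    conv_rhs => rw [hr]
    exact Measure.le_add_right le_rfl

theorem cost_pos_of_ne_zero {d : ℕ} {k : Rd d → ℝ} (hpos : ∀ x, 0 ≤ k x) (h2 : H2 k) {x : Rd d}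
    (hx : x ≠ 0) : 0 < k x := by
  by_contra hle
  have : {y | k y < k x} = ∅ :=
    eq_empty_of_forall_notMem fun y hy => hle ((hpos y).trans_lt hy)
  have h := h2 x hx
  simp [this] at h

/-- `y` is a point of density one of `S`. -/
def IsDensityPoint {d : ℕ} (S : Set (Rd d)) (y : Rd d) : Prop :=
  Tendsto (fun r => volume (Sᶜ ∩ Metric.closedBall y r) / volume (Metric.closedBall y r))
    (nhdsWithin 0 (Ioi 0)) (nhds 0)

theorem ae_isDensityPoint {d : ℕ} {S : Set (Rd d)} (hS : MeasurableSet S) :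
    ∀ᵐ y ∂(volume : Measure (Rd d)), y ∈ S → IsDensityPoint S y := by
  filter_upwards [Besicovitch.ae_tendsto_measure_inter_div_of_measurableSet volume hS.compl]
    with y hy hyS
  simpa [IsDensityPoint, hyS] using hy

theorem measure_inter_eq_zero_of_ae_le {d : ℕ} {k : Rd d → ℝ} {S : Set (Rd d)}
    (hS : MeasurableSet S) {x : Rd d} {a : ℝ}
    (hae : ∀ᵐ z ∂(volume : Measure (Rd d)).restrict S, a ≤ k (z - x)) :
    volume (S ∩ {z | k (z - x) < a}) = 0 := by
  rw [ae_restrict_iff' hS] at hae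
  refine measure_mono_null ?_ hae
  rintro z ⟨hz, hlt⟩ hle
  exact (hle hz).not_gt hlt

theorem eq_of_isDensityPoint_target {d : ℕ} {k : Rd d → ℝ} (h2 : H2 k)
    {S : Set (Rd d)} (hS : MeasurableSet S) {x y : Rd d} (hy : IsDensityPoint S y)
    (hae : ∀ᵐ z ∂(volume : Measure (Rd d)).restrict S, k (y - x) ≤ k (z - x)) : x = y := by
  by_contra hne
  refine (h2 (y - x) (sub_ne_zero.2 (Ne.symm hne))).ne' ?_
  have hnull := measure_inter_eq_zero_of_ae_le hS hae
  refine Tendsto.limsup_eq ?_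
  have hV0 : volume (Metric.ball (0 : Rd d) 1) ≠ 0 := (Metric.measure_ball_pos _ _ one_pos).ne'
  have hVt : volume (Metric.ball (0 : Rd d) 1) ≠ ∞ := measure_ball_lt_top.ne
  have hlim := ENNReal.Tendsto.mul_const (b := volume (Metric.ball (0 : Rd d) 1)) hy (Or.inr hVt)
  rw [zero_mul] at hlim
  refine tendsto_of_tendsto_of_tendsto_of_le_of_le' tendsto_const_nhds hlim
    (Eventually.of_forall fun _ => zero_le) ?_
  filter_upwards [self_mem_nhdsWithin] with r hr
  have hr0 : ENNReal.ofReal (r ^ d) ≠ 0 := by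
    have : 0 < r ^ d := pow_pos hr d
    simpa using this
  have hvol : volume (Metric.closedBall y r)
      = ENNReal.ofReal (r ^ d) * volume (Metric.ball (0 : Rd d) 1) := by
    simpa using Measure.addHaar_closedBall volume y (le_of_lt hr)
  have htrans : volume (Metric.ball (y - x) r ∩ {w | k w < k (y - x)})
      ≤ volume (Sᶜ ∩ Metric.closedBall y r) := by
    have : Metric.ball y r ∩ {z | k (z - x) < k (y - x)}
        = (fun z => z + -x) ⁻¹' (Metric.ball (y - x) r ∩ {w | k w < k (y - x)}) := by
      ext z
      simp [← sub_eq_add_neg]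
    rw [← measure_preimage_add_right volume (-x), ← this]
    refine (measure_mono (t := (Sᶜ ∩ Metric.closedBall y r) ∪
      (S ∩ {z | k (z - x) < k (y - x)})) ?_).trans ((measure_union_le _ _).trans (by simp [hnull]))
    rintro z ⟨hz, hk⟩
    by_cases hzS : z ∈ S
    · exact Or.inr ⟨hzS, hk⟩
    · exact Or.inl ⟨hzS, Metric.ball_subset_closedBall hz⟩
  rw [hvol, ENNReal.div_eq_inv_mul, ENNReal.div_eq_inv_mul,
    ENNReal.mul_inv (Or.inl hr0) (Or.inl ENNReal.ofReal_ne_top)]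
  calc _ ≤ (ENNReal.ofReal (r ^ d))⁻¹ * volume (Sᶜ ∩ Metric.closedBall y r) := by gcongr
    _ = (ENNReal.ofReal (r ^ d))⁻¹ * volume (Sᶜ ∩ Metric.closedBall y r) *
        ((volume (Metric.ball (0 : Rd d) 1))⁻¹ * volume (Metric.ball (0 : Rd d) 1)) := by
      rw [ENNReal.inv_mul_cancel hV0 hVt, mul_one]
    _ = _ := by ring

theorem eq_of_isDensityPoint_source {d : ℕ} {k : Rd d → ℝ} (hpos : ∀ x, 0 ≤ k x) (h1 : H1 k)
    (h2 : H2 k) {S : Set (Rd d)} (hS : MeasurableSet S) {x y : Rd d} (hx : IsDensityPoint S x)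
    (hae : ∀ᵐ z ∂(volume : Measure (Rd d)).restrict S, k (y - x) ≤ k (z - x)) : x = y := by
  by_contra hne
  have hnull := measure_inter_eq_zero_of_ae_le hS hae
  have hk : 0 < k (y - x) := cost_pos_of_ne_zero hpos h2 (sub_ne_zero.2 (Ne.symm hne))
  have hU : {z | k (z - x) < k (y - x)} ∈ nhds x :=
    (h1.1.comp (continuous_id.sub continuous_const)).continuousAt.preimage_mem_nhds
      (Iio_mem_nhds (by simpa [h1.2.1] using hk))
  obtain ⟨ε, hε, hball⟩ := Metric.nhds_basis_closedBall.mem_iff.1 hU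
  have : Tendsto (fun _ : ℝ => (1 : ℝ≥0∞)) (nhdsWithin 0 (Ioi 0)) (nhds 0) := by
    refine Tendsto.congr' ?_ hx
    filter_upwards [Ioc_mem_nhdsGT hε] with r hr
    have h0 : volume (Metric.closedBall x r) ≠ 0 := (Metric.measure_closedBall_pos _ _ hr.1).ne'
    have ht : volume (Metric.closedBall x r) ≠ ∞ := measure_closedBall_lt_top.ne
    have : volume (Sᶜ ∩ Metric.closedBall x r) = volume (Metric.closedBall x r) := by
      have hz : volume (Metric.closedBall x r ∩ S) = 0 :=
        measure_mono_null (t := S ∩ {z | k (z - x) < k (y - x)})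
          (fun z hz => ⟨hz.2, hball (Metric.closedBall_subset_closedBall hr.2 hz.1)⟩) hnull
      rw [← measure_inter_add_sdiff (Metric.closedBall x r) hS, hz, zero_add, inter_comm]
      rfl
    rw [this, ENNReal.div_self h0 ht]
  exact one_ne_zero (tendsto_nhds_unique tendsto_const_nhds this)

/-- On a set left unsaturated by an optimal plan, all mass stays put. -/
theorem IsOptimalPlan.map_snd_eq_of_unsaturated {d : ℕ} {k : Rd d → ℝ} (hpos : ∀ x, 0 ≤ k x)
    (h1 : H1 k) (h2 : H2 k) {F : Measure (Rd d)} {γ : Measure (Rd d × Rd d)} [IsFiniteMeasure γ]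
    (h : IsOptimalPlan (transCost k) F γ) {ν : Measure (Rd d)} [IsFiniteMeasure ν]
    (hν : F + γ.map Prod.snd + ν ≤ volume) {S : Set (Rd d)} (hS : MeasurableSet S)
    (hSν : volume.restrict S ≪ ν) : γ.map Prod.snd S = F S := by
  have hae := Measure.ae_ae_of_ae_prod
    (h.ae_prod_le (measurable_transCost h1.1) (fun _ _ => hpos _) hν)
  have hFle : γ.map Prod.fst ≤ volume := by
    rw [h.map_fst]; exact (Measure.le_add_right le_rfl).trans h.add_map_snd_le
  have hGle : γ.map Prod.snd ≤ volume := (Measure.le_add_left le_rfl).trans h.add_map_snd_le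
  have hx := ae_of_ae_map measurable_fst.aemeasurable (ae_mono hFle (ae_isDensityPoint hS))
  have hy := ae_of_ae_map measurable_snd.aemeasurable (ae_mono hGle (ae_isDensityPoint hS))
  rw [← h.map_fst, Measure.map_apply measurable_fst hS, Measure.map_apply measurable_snd hS]
  refine measure_congr ?_
  filter_upwards [hae, hx, hy] with p hp hpx hpy
  have hp' := hSν.ae_le hp
  refine (propext ⟨fun hm => ?_, fun hm => ?_⟩ : (p.2 ∈ S) = (p.1 ∈ S))
  · have := eq_of_isDensityPoint_target h2 hS (hpy hm) hp'
    rwa [this]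
  · have := eq_of_isDensityPoint_source hpos h1 h2 hS (hpx hm) hp'
    rwa [← this]

theorem compProd_mono_measure {X Y : Type*} [MeasurableSpace X] [MeasurableSpace Y]
    {μ ν : Measure X} [SFinite μ] [SFinite ν] (h : μ ≤ ν) (κ : ProbabilityTheory.Kernel X Y)
    [ProbabilityTheory.IsSFiniteKernel κ] : μ.compProd κ ≤ ν.compProd κ := by
  refine Measure.le_iff.2 fun s hs => ?_
  rw [Measure.compProd_apply hs, Measure.compProd_apply hs]
  exact lintegral_mono' h le_rfl

theorem bind_mono_measure {X Y : Type*} [MeasurableSpace X] [MeasurableSpace Y]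
    {μ ν : Measure X} (h : μ ≤ ν) (κ : ProbabilityTheory.Kernel X Y) :
    μ.bind κ ≤ ν.bind κ := by
  refine Measure.le_iff.2 fun s hs => ?_
  rw [Measure.bind_apply hs κ.measurable.aemeasurable,
    Measure.bind_apply hs κ.measurable.aemeasurable]
  exact lintegral_mono' h le_rfl

theorem withDensity_mono_left {X : Type*} [MeasurableSpace X] {μ ν : Measure X} (h : μ ≤ ν)
    (ρ : X → ℝ≥0∞) : μ.withDensity ρ ≤ ν.withDensity ρ := by
  refine Measure.le_iff.2 fun s hs => ?_
  rw [withDensity_apply _ hs, withDensity_apply _ hs]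
  exact lintegral_mono' (Measure.restrict_mono le_rfl h) le_rfl

/-- Alternately following `γ₁` backwards and `γ₂` forwards, a supply `μ₀` of targets is rerouted
along subplans `α ≤ γ₁` and `β ≤ γ₂` with equal sources; the targets reached by `β` are passed on
to `α` in proportion `ρ`. -/
theorem exists_alternating_subplans {X : Type*} [MeasurableSpace X] [StandardBorelSpace X]
    [Nonempty X] (γ₁ γ₂ : Measure (X × X)) [IsFiniteMeasure γ₁] [IsFiniteMeasure γ₂]
    (hfst : γ₁.map Prod.fst ≤ γ₂.map Prod.fst) (μ₀ : Measure X) (ρ : X → ℝ≥0∞)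
    (hμ₀ : μ₀ + (γ₂.map Prod.snd).withDensity ρ ≤ γ₁.map Prod.snd) :
    ∃ α β : Measure (X × X), α ≤ γ₁ ∧ β ≤ γ₂ ∧ α.map Prod.fst = β.map Prod.fst ∧
      α.map Prod.snd = μ₀ + (β.map Prod.snd).withDensity ρ := by
  set γ₁' := γ₁.map Prod.swap with hγ₁'
  have hfst' : γ₁'.fst = γ₁.map Prod.snd := by
    rw [Measure.fst, hγ₁', Measure.map_map measurable_fst measurable_swap]; rfl
  have hsnd' : γ₁'.snd = γ₁.map Prod.fst := by
    rw [Measure.snd, hγ₁', Measure.map_map measurable_snd measurable_swap]; rfl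
  set P := γ₁'.condKernel
  set Q := γ₂.condKernel
  have hP : γ₁'.fst.compProd P = γ₁' := γ₁'.disintegrate γ₁'.condKernel
  have hQ : γ₂.fst.compProd Q = γ₂ := γ₂.disintegrate γ₂.condKernel
  let Φ : Measure X →o Measure X :=
    { toFun := fun H => μ₀ + ((H.bind P).bind Q).withDensity ρ
      monotone' := fun H H' hH => add_le_add_right
        (withDensity_mono_left (bind_mono_measure (bind_mono_measure hH P) Q) ρ) μ₀ }
  set H := Φ.lfp
  have hfix : μ₀ + ((H.bind P).bind Q).withDensity ρ = H := Φ.map_lfp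
  have hstep : ∀ H' : Measure X, H' ≤ γ₁'.fst → H'.bind P ≤ γ₂.fst := by
    intro H' hH'
    refine (bind_mono_measure hH' P).trans ?_
    rw [← Measure.snd_compProd, hP, hsnd']
    exact hfst
  have hH : H ≤ γ₁'.fst := by
    refine Φ.lfp_le ?_
    refine le_trans ?_ (hμ₀.trans hfst'.ge)
    refine add_le_add_right (withDensity_mono_left ?_ ρ) μ₀
    refine (bind_mono_measure (hstep _ le_rfl) Q).trans ?_
    rw [← Measure.snd_compProd, hQ]
    exact le_rfl
  have : IsFiniteMeasure H := isFiniteMeasure_of_le _ hH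
  have hHP : H.bind P ≤ γ₂.fst := hstep H hH
  have : IsFiniteMeasure (H.bind P) := isFiniteMeasure_of_le _ hHP
  refine ⟨(H.compProd P).map Prod.swap, (H.bind P).compProd Q, ?_, ?_, ?_, ?_⟩
  · refine (Measure.map_mono (compProd_mono_measure hH P) measurable_swap).trans ?_
    rw [hP, hγ₁', Measure.map_map measurable_swap measurable_swap]
    simp
  · exact (compProd_mono_measure hHP Q).trans hQ.le
  · rw [Measure.map_map measurable_fst measurable_swap]
    change (H.compProd P).snd = ((H.bind P).compProd Q).fst
    rw [Measure.snd_compProd, Measure.fst_compProd]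
  · rw [Measure.map_map measurable_snd measurable_swap]
    change (H.compProd P).fst = μ₀ + ((H.bind P).compProd Q).snd.withDensity ρ
    rw [Measure.snd_compProd, Measure.fst_compProd, hfix]

theorem half_smul_add_half_smul {X : Type*} [MeasurableSpace X] (μ : Measure X) :
    (2⁻¹ : ℝ≥0∞) • μ + (2⁻¹ : ℝ≥0∞) • μ = μ := by
  rw [← add_smul, ENNReal.inv_two_add_inv_two, one_smul]

/-- If `α` and `β` are subplans with equal sources of optimal plans for `F₁` and `F₂`, and swapping
half of `α` with half of `β` is admissible for both, then the swapped plan is optimal for `F₁`. -/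
theorem IsOptimalPlan.swap_half {d : ℕ} {c : Rd d → Rd d → ℝ} {F₁ F₂ : Measure (Rd d)}
    {r₁ r₂ α β : Measure (Rd d × Rd d)} (h₁ : IsOptimalPlan c F₁ (r₁ + α))
    (h₂ : IsOptimalPlan c F₂ (r₂ + β)) (hfst : α.map Prod.fst = β.map Prod.fst)
    (hle₁ : F₁ + (r₁ + ((2⁻¹ : ℝ≥0∞) • α + (2⁻¹ : ℝ≥0∞) • β)).map Prod.snd ≤ volume)
    (hle₂ : F₂ + (r₂ + ((2⁻¹ : ℝ≥0∞) • α + (2⁻¹ : ℝ≥0∞) • β)).map Prod.snd ≤ volume) :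
    IsOptimalPlan c F₁ (r₁ + ((2⁻¹ : ℝ≥0∞) • α + (2⁻¹ : ℝ≥0∞) • β)) := by
  set η := (2⁻¹ : ℝ≥0∞) • α + (2⁻¹ : ℝ≥0∞) • β with hη
  have hηα : η.map Prod.fst = α.map Prod.fst := by
    rw [hη, Measure.map_add _ _ measurable_fst, Measure.map_smul, Measure.map_smul, ← hfst,
      half_smul_add_half_smul]
  have hfst₁ : (r₁ + η).map Prod.fst = F₁ := by
    rw [← h₁.map_fst, Measure.map_add r₁ η measurable_fst,
      Measure.map_add r₁ α measurable_fst, hηα]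
  have hfst₂ : (r₂ + η).map Prod.fst = F₂ := by
    rw [← h₂.map_fst, Measure.map_add r₂ η measurable_fst,
      Measure.map_add r₂ β measurable_fst, hηα,
      hfst]
  have hη2 : η + η = α + β := by
    rw [hη, add_add_add_comm, half_smul_add_half_smul, half_smul_add_half_smul]
  have hm₂ := h₂.planCost_le _ hfst₂ hle₂
  have hf₁ := h₁.planCost_ne_top
  have hf₂ := h₂.planCost_ne_top
  have hη2' := congrArg (planCost c) hη2
  simp only [planCost_add] at hm₂ hf₁ hf₂ hη2'
  rw [ENNReal.add_ne_top] at hf₁ hf₂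
  have hβη := ENNReal.le_of_add_le_add_left hf₂.1 hm₂
  have hηα : planCost c η ≤ planCost c α := by
    by_contra! hlt
    have := ENNReal.add_lt_add_of_lt_of_le hf₂.2 hlt hβη
    exact this.ne hη2'.symm
  have hle : planCost c (r₁ + η) ≤ planCost c (r₁ + α) := by
    rw [planCost_add c r₁ η, planCost_add c r₁ α]
    exact add_le_add_right hηα _
  refine ⟨hfst₁, hle₁, ne_top_of_le_ne_top h₁.planCost_ne_top hle, fun γ' hγ' hγ'' => ?_⟩
  exact hle.trans (h₁.planCost_le γ' hγ' hγ'')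

theorem ae_le_of_withDensity_le {d : ℕ} {f g : Rd d → ℝ≥0∞} (hf : Measurable f)
    (h : volume.withDensity f ≤ volume.withDensity g) : f ≤ᵐ[volume] g := by
  refine ae_le_of_forall_setLIntegral_le_of_sigmaFinite hf fun s hs _ => ?_
  rw [← withDensity_apply _ hs, ← withDensity_apply _ hs]
  exact h s

theorem exists_eq_withDensity {d : ℕ} {μ : Measure (Rd d)} [IsFiniteMeasure μ]
    (h : μ ≤ volume) : ∃ f : Rd d → ℝ≥0∞, Measurable f ∧ μ = volume.withDensity f :=
  ⟨μ.rnDeriv volume, Measure.measurable_rnDeriv _ _,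
    (Measure.withDensity_rnDeriv_eq _ _ (Measure.absolutelyContinuous_of_le h)).symm⟩

/-- The excess of `a₁ + b₁` over `a₂ + b₂` is bounded by `b₁ - min b₁ b₂` when `a₁ ≤ a₂`. -/
theorem tsub_add_min_le {a₁ a₂ b₁ b₂ : ℝ≥0∞} (ha : a₁ ≤ a₂) :
    (a₁ + b₁ - (a₂ + b₂)) + min b₁ b₂ ≤ b₁ := by
  rcases le_total b₁ b₂ with hb | hb
  · rw [tsub_eq_zero_of_le (add_le_add ha hb), zero_add]
    exact min_le_left _ _
  · rw [min_eq_right hb]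
    have h : a₁ + b₁ - (a₂ + b₂) ≤ b₁ - b₂ := by
      rw [tsub_le_iff_right]
      calc a₁ + b₁ ≤ a₂ + (b₁ - b₂ + b₂) := by
            rw [tsub_add_cancel_of_le hb]; gcongr
        _ = _ := by ring
    exact (add_le_add_left h _).trans (tsub_add_cancel_of_le hb).le

/-- The saturated measure `F + γ.map Prod.snd` of optimal plans is monotone in `F`. -/
theorem IsOptimalPlan.add_map_snd_mono {d : ℕ} {k : Rd d → ℝ} (hpos : ∀ x, 0 ≤ k x)
    (h1 : H1 k) (h2 : H2 k) {F₁ F₂ : Measure (Rd d)} {γ₁ γ₂ : Measure (Rd d × Rd d)}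
    [IsFiniteMeasure γ₁] [IsFiniteMeasure γ₂] (h₁ : IsOptimalPlan (transCost k) F₁ γ₁)
    (h₂ : IsOptimalPlan (transCost k) F₂ γ₂) (hF : F₁ ≤ F₂) :
    F₁ + γ₁.map Prod.snd ≤ F₂ + γ₂.map Prod.snd := by
  set G₁ := γ₁.map Prod.snd with hG₁
  set G₂ := γ₂.map Prod.snd with hG₂
  have : IsFiniteMeasure F₁ := by rw [← h₁.map_fst]; infer_instance
  have : IsFiniteMeasure F₂ := by rw [← h₂.map_fst]; infer_instance
  have hle₁ := h₁.add_map_snd_le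
  have hle₂ := h₂.add_map_snd_le
  obtain ⟨f₁, hf₁m, hf₁⟩ := exists_eq_withDensity ((Measure.le_add_right le_rfl).trans hle₁)
  obtain ⟨f₂, hf₂m, hf₂⟩ := exists_eq_withDensity ((Measure.le_add_right le_rfl).trans hle₂)
  obtain ⟨g₁, hg₁m, hg₁⟩ := exists_eq_withDensity ((Measure.le_add_left le_rfl).trans hle₁)
  obtain ⟨g₂, hg₂m, hg₂⟩ := exists_eq_withDensity ((Measure.le_add_left le_rfl).trans hle₂)
  rw [← hG₁] at hg₁ hle₁
  rw [← hG₂] at hg₂ hle₂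
  have hae : f₁ ≤ᵐ[volume] f₂ := ae_le_of_withDensity_le hf₁m (by rwa [← hf₁, ← hf₂])
  have hae₁ : f₁ + g₁ ≤ᵐ[volume] 1 := by
    refine ae_le_of_withDensity_le (hf₁m.add hg₁m) ?_
    rw [withDensity_add_left hf₁m, ← hf₁, ← hg₁, withDensity_one]
    exact hle₁
  have hae₂ : f₂ + g₂ ≤ᵐ[volume] 1 := by
    refine ae_le_of_withDensity_le (hf₂m.add hg₂m) ?_
    rw [withDensity_add_left hf₂m, ← hf₂, ← hg₂, withDensity_one]
    exact hle₂
  set u : Rd d → ℝ≥0∞ := fun x => f₁ x + g₁ x - (f₂ x + g₂ x) with hu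
  have hum : Measurable u := by fun_prop
  set ρ : Rd d → ℝ≥0∞ := fun x => min (g₁ x / g₂ x) 1 with hρ
  have hρm : Measurable ρ := (hg₁m.div hg₂m).min measurable_const
  set μ₀ := volume.withDensity u with hμ₀
  set ν := volume.withDensity (g₂ - g₁) with hν
  have hgρ : ∀ᵐ x, g₂ x * ρ x = min (g₁ x) (g₂ x) := by
    filter_upwards [hae₂] with x hx
    have hgt : g₂ x ≠ ∞ := ne_top_of_le_ne_top one_ne_top (le_add_self.trans hx)
    rcases eq_or_ne (g₂ x) 0 with h0 | h0
    · simp [h0]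
    · rw [hρ]
      dsimp only
      rw [mul_min, ENNReal.mul_div_cancel h0 hgt, mul_one]
  have hG₂ρ : G₂.withDensity ρ = volume.withDensity fun x => min (g₁ x) (g₂ x) := by
    rw [hg₂, ← withDensity_mul _ hg₂m hρm]
    exact withDensity_congr_ae hgρ
  have hsupply : μ₀ + G₂.withDensity ρ ≤ G₁ := by
    rw [hG₂ρ, hμ₀, ← withDensity_add_left hum, hg₁]
    refine withDensity_mono ?_
    filter_upwards [hae] with x hx
    exact tsub_add_min_le hx
  obtain ⟨α, β, hα, hβ, hαβ, hαsnd⟩ := exists_alternating_subplans γ₁ γ₂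
    (by rw [h₁.map_fst, h₂.map_fst]; exact hF) μ₀ ρ hsupply
  have : IsFiniteMeasure α := isFiniteMeasure_of_le _ hα
  have : IsFiniteMeasure β := isFiniteMeasure_of_le _ hβ
  set N := β.map Prod.snd with hN
  set b := N.withDensity (1 - ρ) with hb
  have hρm' : Measurable (1 - ρ) := hρm.const_sub 1
  have hsplit : N.withDensity ρ + b = N := by
    rw [hb, ← withDensity_add_left hρm]
    conv_rhs => rw [← withDensity_one (μ := N)]
    congr 1
    ext x
    exact add_tsub_cancel_of_le (min_le_right _ _)
  have hbν : b ≤ ν := by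
    refine (withDensity_mono_left (Measure.map_mono hβ measurable_snd) _).trans ?_
    rw [← hG₂, hg₂, ← withDensity_mul _ hg₂m hρm', hν]
    refine withDensity_mono ?_
    filter_upwards [hgρ, hae₂] with x hx hx₂
    have hgt : g₂ x ≠ ∞ := ne_top_of_le_ne_top one_ne_top (le_add_self.trans hx₂)
    change g₂ x * (1 - ρ x) ≤ g₂ x - g₁ x
    rw [ENNReal.mul_sub fun _ _ => hgt, mul_one, hx]
    rcases le_total (g₁ x) (g₂ x) with h | h
    · rw [min_eq_left h]
    · simp [min_eq_right h]
  have hνG : ν ≤ G₂ := by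
    rw [hg₂]; exact withDensity_mono (Eventually.of_forall fun x => tsub_le_self)
  have : IsFiniteMeasure ν := isFiniteMeasure_of_le _ hνG
  have hν₁ : F₁ + G₁ + ν ≤ volume := by
    rw [hf₁, hg₁, hν, ← withDensity_add_left hf₁m, ← withDensity_add_left (hf₁m.add hg₁m)]
    conv_rhs => rw [← withDensity_one (μ := volume)]
    refine withDensity_mono ?_
    filter_upwards [hae, hae₁, hae₂] with x hx hx₁ hx₂
    change f₁ x + g₁ x + (g₂ x - g₁ x) ≤ 1
    rw [add_assoc, add_tsub_eq_max]
    rcases le_total (g₁ x) (g₂ x) with h | h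
    · rw [max_eq_right h]; exact (add_le_add_left hx _).trans hx₂
    · rw [max_eq_left h]; exact hx₁
  have hμ₂ : F₂ + (G₂ + μ₀) ≤ volume := by
    rw [← add_assoc, hf₂, hg₂, hμ₀, ← withDensity_add_left hf₂m,
      ← withDensity_add_left (hf₂m.add hg₂m)]
    conv_rhs => rw [← withDensity_one (μ := volume)]
    refine withDensity_mono ?_
    filter_upwards [hae₁, hae₂] with x hx₁ hx₂
    change f₂ x + g₂ x + (f₁ x + g₁ x - (f₂ x + g₂ x)) ≤ 1
    rw [add_tsub_eq_max]
    exact max_le hx₂ hx₁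
  obtain ⟨r₁, hr₁⟩ : ∃ r, γ₁ = r + α := ⟨γ₁ - α, (Measure.sub_add_cancel_of_le hα).symm⟩
  obtain ⟨r₂, hr₂⟩ : ∃ r, γ₂ = r + β := ⟨γ₂ - β, (Measure.sub_add_cancel_of_le hβ).symm⟩
  set η := (2⁻¹ : ℝ≥0∞) • α + (2⁻¹ : ℝ≥0∞) • β with hη
  have hηsnd : η.map Prod.snd = (2⁻¹ : ℝ≥0∞) • μ₀ + N.withDensity ρ + (2⁻¹ : ℝ≥0∞) • b := by
    rw [hη, Measure.map_add _ _ measurable_snd, Measure.map_smul, Measure.map_smul, hαsnd, ← hN]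
    conv_lhs => enter [2]; rw [← hsplit]
    conv_rhs => enter [1, 2]; rw [← half_smul_add_half_smul (N.withDensity ρ)]
    rw [smul_add, smul_add]
    abel
  have hbal₁ : (r₁ + η).map Prod.snd + (2⁻¹ : ℝ≥0∞) • μ₀ = G₁ + (2⁻¹ : ℝ≥0∞) • b := by
    rw [hG₁, hr₁, Measure.map_add r₁ η measurable_snd,
      Measure.map_add r₁ α measurable_snd, hηsnd,
      hαsnd]
    conv_rhs => enter [1, 2, 1]; rw [← half_smul_add_half_smul μ₀]
    abel
  have hbal₂ : (r₂ + η).map Prod.snd + (2⁻¹ : ℝ≥0∞) • b = G₂ + (2⁻¹ : ℝ≥0∞) • μ₀ := by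
    rw [hG₂, hr₂, Measure.map_add r₂ η measurable_snd,
      Measure.map_add r₂ β measurable_snd, hηsnd,
      ← hN]
    conv_rhs => enter [1, 2]; rw [← hsplit, ← half_smul_add_half_smul b]
    abel
  have half_le : ∀ μ : Measure (Rd d), (2⁻¹ : ℝ≥0∞) • μ ≤ μ := fun μ => by
    conv_rhs => rw [← half_smul_add_half_smul μ]
    exact Measure.le_add_right le_rfl
  have hadm₁ : F₁ + (r₁ + η).map Prod.snd + (2⁻¹ : ℝ≥0∞) • ν ≤ volume := by
    refine le_trans ?_ hν₁
    rw [add_assoc, add_assoc]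
    refine add_le_add_right ?_ F₁
    calc _ ≤ (r₁ + η).map Prod.snd + (2⁻¹ : ℝ≥0∞) • μ₀ + (2⁻¹ : ℝ≥0∞) • ν :=
          add_le_add_left (Measure.le_add_right le_rfl) _
      _ = G₁ + ((2⁻¹ : ℝ≥0∞) • b + (2⁻¹ : ℝ≥0∞) • ν) := by rw [hbal₁, add_assoc]
      _ ≤ G₁ + ((2⁻¹ : ℝ≥0∞) • ν + (2⁻¹ : ℝ≥0∞) • ν) := by gcongr
      _ = G₁ + ν := by rw [half_smul_add_half_smul]
  have hadm₂ : F₂ + (r₂ + η).map Prod.snd ≤ volume := by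
    refine le_trans (add_le_add_right ?_ F₂) hμ₂
    calc _ ≤ (r₂ + η).map Prod.snd + (2⁻¹ : ℝ≥0∞) • b := Measure.le_add_right le_rfl
      _ = G₂ + (2⁻¹ : ℝ≥0∞) • μ₀ := hbal₂
      _ ≤ _ := add_le_add_right (half_le _) _
  have hopt : IsOptimalPlan (transCost k) F₁ (r₁ + η) :=
    IsOptimalPlan.swap_half (hr₁ ▸ h₁) (hr₂ ▸ h₂) hαβ
      ((Measure.le_add_right le_rfl).trans hadm₁) hadm₂
  have : IsFiniteMeasure (r₁ + η) := by
    have : IsFiniteMeasure ((r₁ + η).map Prod.fst) := by rw [hopt.map_fst]; infer_instance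
    exact Measure.isFiniteMeasure_of_map measurable_fst.aemeasurable
  have : IsFiniteMeasure ((2⁻¹ : ℝ≥0∞) • ν) := isFiniteMeasure_of_le _ (half_le ν)
  set S := {x | g₁ x < g₂ x} with hS
  have hSm : MeasurableSet S := measurableSet_lt hg₁m hg₂m
  have hSν : volume.restrict S ≪ ν := by
    rw [hν]
    refine Measure.AbsolutelyContinuous.trans ?_
      (Measure.absolutelyContinuous_of_le (Measure.restrict_le_self (s := S)))
    rw [restrict_withDensity hSm]
    refine withDensity_absolutelyContinuous' (hg₂m.sub hg₁m).aemeasurable ?_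
    filter_upwards [ae_restrict_mem hSm] with x hx
    exact (tsub_pos_of_lt hx).ne'
  have hSν' : volume.restrict S ≪ (2⁻¹ : ℝ≥0∞) • ν :=
    hSν.trans (Measure.absolutelyContinuous_smul (by simp))
  have hG₁S := h₁.map_snd_eq_of_unsaturated hpos h1 h2 hν₁ hSm hSν
  have hG₁S' := hopt.map_snd_eq_of_unsaturated hpos h1 h2 hadm₁ hSm hSν'
  have hμ₀S : μ₀ S = 0 := by
    rw [hμ₀, withDensity_apply _ hSm]
    refine (setLIntegral_congr_fun_ae hSm ?_).trans lintegral_zero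
    filter_upwards [hae] with x hx hxS
    exact tsub_eq_zero_of_le (add_le_add hx (le_of_lt hxS))
  have hbS : b S = 0 := by
    have := congrArg (fun μ : Measure _ => μ S) hbal₁
    simp only [Measure.add_apply, Measure.smul_apply, hμ₀S] at this
    rw [hG₁S', hG₁, hG₁S] at this
    have hz : F₁ S + 0 = F₁ S + (2⁻¹ : ℝ≥0∞) * b S := by simpa using this
    have := (ENNReal.add_right_inj (measure_ne_top F₁ S)).1 hz
    simpa using this.symm
  have hνS : ν Sᶜ = 0 := by
    rw [hν, withDensity_apply _ hSm.compl]
    refine (setLIntegral_congr_fun hSm.compl fun x hx => ?_).trans lintegral_zero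
    exact tsub_eq_zero_of_le (not_lt.1 hx)
  have hb0 : b univ = 0 := by
    rw [← union_compl_self S]
    exact measure_union_null hbS (le_antisymm ((hbν _).trans hνS.le) zero_le)
  have hμ₀0 : μ₀ = 0 := by
    have hα1 : α.map Prod.snd univ = α univ := by simp [Measure.map_apply measurable_snd]
    have hβ1 : N univ = β univ := by simp [hN, Measure.map_apply measurable_snd]
    have hmass : α univ = β univ := by
      have := congrArg (fun μ : Measure _ => μ univ) hαβ
      simpa [Measure.map_apply measurable_fst] using this
    have hN1 := congrArg (fun μ : Measure _ => μ univ) hsplit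
    rw [Measure.coe_add, Pi.add_apply, hb0, add_zero] at hN1
    rw [hαsnd, hmass, ← hβ1, Measure.coe_add, Pi.add_apply, hN1] at hα1
    refine Measure.measure_univ_eq_zero.1 ?_
    have hz : μ₀ univ + N univ = 0 + N univ := by rw [hα1, zero_add]
    exact (ENNReal.add_left_inj (measure_ne_top N univ)).1 hz
  rw [hμ₀, withDensity_eq_zero_iff hum.aemeasurable] at hμ₀0
  rw [hf₁, hf₂, hg₁, hg₂, ← withDensity_add_left hf₁m, ← withDensity_add_left hf₂m]
  refine withDensity_mono ?_
  filter_upwards [hμ₀0] with x hx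
  exact tsub_eq_zero_iff_le.1 hx

theorem exists_volume_ball_ge {d : ℕ} (hd : 1 ≤ d) {a : ℝ≥0∞} (ha : a ≠ ∞) :
    ∃ R : ℝ, ∀ x : Rd d, a ≤ volume (Metric.ball x R) := by
  have : Nonempty (Fin d) := ⟨⟨0, hd⟩⟩
  have : Nontrivial (Rd d) := inferInstance
  have htop : volume (univ : Set (Rd d)) = ∞ := measure_univ_of_isAddLeftInvariant _
  have hlim : Tendsto (fun n : ℕ => volume (Metric.ball (0 : Rd d) n)) atTop (nhds ∞) := by
    rw [← htop, ← Metric.iUnion_ball_nat (0 : Rd d)]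
    exact tendsto_measure_iUnion_atTop fun m n hmn => Metric.ball_subset_ball (by exact_mod_cast hmn)
  obtain ⟨n, hn⟩ := (hlim.eventually (lt_mem_nhds ha.lt_top)).exists
  exact ⟨n, fun x => by rw [Measure.addHaar_ball_center]; exact hn.le⟩

/-- Finite-cost exterior transport plans exist: spread mass over balls of large fixed radius. -/
theorem exists_plan_planCost_ne_top {d : ℕ} (hd : 1 ≤ d) {k : Rd d → ℝ} (hk : Continuous k)
    {F : Measure (Rd d)} [IsFiniteMeasure F] (hF : F ≤ volume) :
    ∃ γ : Measure (Rd d × Rd d), γ.map Prod.fst = F ∧ F + γ.map Prod.snd ≤ volume ∧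
      planCost (transCost k) γ ≠ ∞ := by
  set W := (volume : Measure (Rd d)) - F
  have hFW : F + W = volume := by rw [add_comm]; exact Measure.sub_add_cancel_of_le hF
  have hWle : W ≤ volume := hFW ▸ Measure.le_add_left le_rfl
  have : SigmaFinite W := Measure.sigmaFinite_of_le _ hWle
  obtain ⟨R, hR⟩ := exists_volume_ball_ge hd (a := F univ + (F univ + 1))
    (by simp [measure_ne_top])
  set N : Rd d → ℝ≥0∞ := fun x => W (Metric.ball x R)
  have hN : ∀ x, F univ + 1 ≤ N x := fun x => by
    have h := hR x
    rw [← hFW] at h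
    refine ENNReal.le_of_add_le_add_left (measure_ne_top F univ) (h.trans ?_)
    rw [Measure.add_apply]
    exact add_le_add_left (measure_mono (subset_univ _)) _
  have hN0 : ∀ x, N x ≠ 0 := fun x h0 => by simpa [h0] using hN x
  have hNt : ∀ x, N x ≠ ∞ := fun x => ((hWle _).trans_lt measure_ball_lt_top).ne
  set B : Set (Rd d × Rd d) := {p | dist p.2 p.1 < R}
  have hB : MeasurableSet B := measurableSet_lt (by fun_prop) measurable_const
  have hNm : Measurable N := measurable_measure_prodMk_left hB
  set D : Rd d × Rd d → ℝ≥0∞ := B.indicator fun p => (N p.1)⁻¹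
  have hD : Measurable D := (hNm.comp measurable_fst).inv.indicator hB
  set γ := (F.prod W).withDensity D with hγ
  have hfst : γ.map Prod.fst = F := by
    ext s hs
    have hsm : MeasurableSet (Prod.fst ⁻¹' s : Set (Rd d × Rd d)) := measurable_fst hs
    rw [Measure.map_apply measurable_fst hs, withDensity_apply _ hsm, ← prod_univ,
      ← Measure.prod_restrict, Measure.restrict_univ, lintegral_prod _ hD.aemeasurable]
    refine (lintegral_congr fun x => ?_).trans (setLIntegral_one s)
    have : (fun y => D (x, y)) = (Metric.ball x R).indicator fun _ => (N x)⁻¹ := rfl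
    rw [this, lintegral_indicator_const measurableSet_ball, ENNReal.inv_mul_cancel (hN0 x) (hNt x)]
  have hsnd : γ.map Prod.snd ≤ W := by
    refine Measure.le_iff.2 fun s hs => ?_
    have hsm : MeasurableSet (Prod.snd ⁻¹' s : Set (Rd d × Rd d)) := measurable_snd hs
    rw [Measure.map_apply measurable_snd hs, withDensity_apply _ hsm, ← univ_prod,
      ← Measure.prod_restrict, Measure.restrict_univ, lintegral_prod_symm _ hD.aemeasurable,
      ← setLIntegral_one s]
    refine lintegral_mono fun y => ?_
    calc ∫⁻ x, D (x, y) ∂F ≤ ∫⁻ _, (F univ)⁻¹ ∂F := by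
          refine lintegral_mono fun x => (indicator_le_self _ _ _).trans ?_
          exact ENNReal.inv_le_inv.2 (le_self_add.trans (hN x))
      _ ≤ 1 := by rw [lintegral_const]; exact ENNReal.inv_mul_le_one _
  refine ⟨γ, hfst, hFW ▸ add_le_add_right hsnd F, ?_⟩
  obtain ⟨C, hC⟩ := (isCompact_closedBall (0 : Rd d) R).bddAbove_image hk.continuousOn
  have hCγ : ∀ᵐ p ∂γ, ENNReal.ofReal (transCost k p.1 p.2) ≤ ENNReal.ofReal C := by
    rw [hγ, ae_withDensity_iff hD]
    refine Eventually.of_forall fun p hp => ENNReal.ofReal_le_ofReal (hC ⟨p.2 - p.1, ?_, rfl⟩)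
    have hpB : p ∈ B := mem_of_indicator_ne_zero hp
    have : dist p.2 p.1 < R := hpB
    simpa [dist_eq_norm] using this.le
  have hγu : γ univ = F univ := by
    rw [← hfst, Measure.map_apply measurable_fst MeasurableSet.univ, preimage_univ]
  refine ne_top_of_le_ne_top ?_ (lintegral_mono_ae hCγ)
  rw [lintegral_const, hγu]
  exact ENNReal.mul_ne_top ENNReal.ofReal_ne_top (measure_ne_top F univ)

theorem isFiniteMeasure_fMeas {d : ℕ} {f : Rd d → ℝ} (hf : InUnit f) :
    IsFiniteMeasure (fMeas f) :=
  isFiniteMeasure_withDensity_ofReal hf.1.2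

theorem mem_extPlans_iff {d : ℕ} {f : Rd d → ℝ} (hf : InUnit f) {γ : Measure (Rd d × Rd d)} :
    γ ∈ ExtPlans f ↔ γ.map Prod.fst = fMeas f ∧ fMeas f + γ.map Prod.snd ≤ volume := by
  have := isFiniteMeasure_fMeas hf
  refine and_congr_right fun _ => ?_
  rw [← fMeas_add_fMeas_one_sub hf]
  refine ⟨fun h => add_le_add_right h _, fun h s => ?_⟩
  exact ENNReal.le_of_add_le_add_left (measure_ne_top (fMeas f) s) (h s)

theorem isOptimalPlan_of_planCost_eq {d : ℕ} (hd : 1 ≤ d) {k : Rd d → ℝ} (hk : Continuous k)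
    {f : Rd d → ℝ} (hf : InUnit f) {γ : Measure (Rd d × Rd d)} (hγ : γ ∈ ExtPlans f)
    (hopt : planCost (transCost k) γ = Ups (transCost k) f) :
    IsOptimalPlan (transCost k) (fMeas f) γ := by
  have := isFiniteMeasure_fMeas hf
  have hmin : ∀ γ' : Measure (Rd d × Rd d), γ'.map Prod.fst = fMeas f →
      fMeas f + γ'.map Prod.snd ≤ volume →
      planCost (transCost k) γ ≤ planCost (transCost k) γ' := fun γ' h h' =>
    hopt.trans_le (iInf₂_le γ' ((mem_extPlans_iff hf).2 ⟨h, h'⟩))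
  obtain ⟨γ', h, h', hfin⟩ := exists_plan_planCost_ne_top hd hk
    ((Measure.le_add_right le_rfl).trans (fMeas_add_fMeas_one_sub hf).le)
  have hmem := (mem_extPlans_iff hf).1 hγ
  exact ⟨hmem.1, hmem.2, ne_top_of_le_ne_top hfin (hmin γ' h h'), hmin⟩

theorem isFiniteMeasure_of_mem_extPlans {d : ℕ} {f : Rd d → ℝ} (hf : InUnit f)
    {γ : Measure (Rd d × Rd d)} (hγ : γ ∈ ExtPlans f) : IsFiniteMeasure γ := by
  have := isFiniteMeasure_fMeas hf
  have : IsFiniteMeasure (γ.map Prod.fst) := by rw [hγ.1]; infer_instance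
  exact Measure.isFiniteMeasure_of_map measurable_fst.aemeasurable

/-- under (H1),(H2), if `f₁ ≤ f₂` and `γ¹, γ²` are respective minimisers of
`Υ(f₁)`, `Υ(f₂)` with second marginals `g₁, g₂`, then `f₁ + g₁ ≤ f₂ + g₂` (as measures, which
amounts to the Lebesgue-a.e. inequality of the densities). -/
theorem stmt_16 {d : ℕ} (hd : 1 ≤ d) (k : Rd d → ℝ) (hpos : ∀ x, 0 ≤ k x)
    (h1 : H1 k) (h2 : H2 k) (m : ℝ) (hm : 0 < m)
    (f₁ f₂ : Rd d → ℝ) (hf₁ : MemL1m m f₁) (hf₂ : MemL1m m f₂) (hle : ∀ x, f₁ x ≤ f₂ x)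
    (γ₁ γ₂ : Measure (Rd d × Rd d)) (hγ₁ : γ₁ ∈ ExtPlans f₁) (hγ₂ : γ₂ ∈ ExtPlans f₂)
    (hopt₁ : planCost (transCost k) γ₁ = Ups (transCost k) f₁)
    (hopt₂ : planCost (transCost k) γ₂ = Ups (transCost k) f₂) :
    fMeas f₁ + γ₁.map Prod.snd ≤ fMeas f₂ + γ₂.map Prod.snd := by
  have := isFiniteMeasure_of_mem_extPlans hf₁.1 hγ₁
  have := isFiniteMeasure_of_mem_extPlans hf₂.1 hγ₂
  refine IsOptimalPlan.add_map_snd_mono hpos h1 h2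
    (isOptimalPlan_of_planCost_eq hd h1.1 hf₁.1 hγ₁ hopt₁)
    (isOptimalPlan_of_planCost_eq hd h1.1 hf₂.1 hγ₂ hopt₂) ?_
  exact withDensity_mono (Eventually.of_forall fun x => ENNReal.ofReal_le_ofReal (hle x))
end
end
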